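/- arXiv:2402.07560 — 10 statements merged into one kernel-verified Lean document; each statement's English description precedes it below -/
import Mathlib

section
/- Assume the Riccati identity with R = 0, i.e. A∘Q + Q∘A* − B∘W∘B* + 2λ·Q = 0, assume A is skew-adjoint (A* = −A), and let λ₁ ∈ ℝ satisfy λ₁ > 2λ. Then there exists a constant C > 0 (independent of the solution and of t) such that: for every pair of differentiable functions y, ỹ : [0,∞) → H satisfying, for all t ≥ 0, y′(t) = A y(t) − B W B* ỹ(t) and ỹ′(t) = −A* ỹ(t) − 2λ ỹ(t) + λ₁ Q⁻¹(y(t) − Q ỹ(t)), one has ‖y(t)‖ + ‖ỹ(t)‖ ≤ C·e^{−2λt}·(‖y(0)‖ + ‖ỹ(0)‖) for all t ≥ 0. -/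
open ContinuousLinearMap
open scoped RealInnerProductSpace

/-- The exponential of a skew-adjoint bounded operator preserves the norm. -/
theorem norm_exp_smul_apply_of_adjoint_eq_neg
    {H : Type*} [NormedAddCommGroup H] [InnerProductSpace ℝ H] [CompleteSpace H]
    {A : H →L[ℝ] H} (hA : adjoint A = -A) (t : ℝ) (x : H) :
    ‖NormedSpace.exp (t • A) x‖ = ‖x‖ := by
  have hmem : t • A ∈ skewAdjoint (H →L[ℝ] H) := by
    rw [skewAdjoint.mem_iff, star_smul, star_eq_adjoint, hA, star_trivial, smul_neg]
  let : NormedAlgebra ℚ (H →L[ℝ] H) := NormedAlgebra.restrictScalars ℚ ℝ _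
  have hunit := NormedSpace.exp_mem_unitary_of_mem_skewAdjoint hmem
  exact (ContinuousLinearMap.norm_map_iff_adjoint_comp_self _).mpr hunit.1 x

/-- A solution of `v' = A v + f` with `A` skew-adjoint grows at most as fast as a primitive
of a bound on `‖f‖`. -/
theorem norm_le_of_hasDerivAt_skewAdjoint_add
    {H : Type*} [NormedAddCommGroup H] [InnerProductSpace ℝ H] [CompleteSpace H]
    {A : H →L[ℝ] H} (hA : adjoint A = -A) {v f : ℝ → H} {g g' : ℝ → ℝ}
    (hv : ∀ t, 0 ≤ t → HasDerivAt v (A (v t) + f t) t)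
    (hg : ∀ t, HasDerivAt g (g' t) t) (hf : ∀ t, 0 ≤ t → ‖f t‖ ≤ g' t)
    (h0 : ‖v 0‖ ≤ g 0) {t : ℝ} (ht : 0 ≤ t) : ‖v t‖ ≤ g t := by
  have hnorm := norm_exp_smul_apply_of_adjoint_eq_neg (A := -A) (by rw [map_neg, hA])
  have hu : ∀ s, 0 ≤ s → HasDerivAt (fun s => NormedSpace.exp (s • -A) (v s))
      (NormedSpace.exp (s • -A) (f s)) s := by
    intro s hs
    convert (hasDerivAt_exp_smul_const (𝕂 := ℝ) (-A) s).clm_apply (hv s hs) using 1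
    simp
  have hle := image_norm_le_of_norm_deriv_right_le_deriv_boundary
    (f := fun s => NormedSpace.exp (s • -A) (v s)) (a := 0) (b := t)
    (fun s hs => (hu s hs.1).continuousAt.continuousWithinAt)
    (fun s hs => (hu s hs.1).hasDerivWithinAt) (by simpa [hnorm] using h0) hg
    (fun s hs => by rw [hnorm]; exact hf s hs.1) (Set.right_mem_Icc.mpr ht)
  rwa [hnorm] at hle

/-- Multiplying by `e^{ct}` removes a scalar damping `c` from a linear equation. -/
theorem hasDerivAt_exp_smul_of_damped
    {H : Type*} [NormedAddCommGroup H] [NormedSpace ℝ H]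
    {A : H →L[ℝ] H} {c t : ℝ} {v : ℝ → H} {w : H}
    (hv : HasDerivAt v (A (v t) - c • v t + w) t) :
    HasDerivAt (fun s => Real.exp (c * s) • v s)
      (A (Real.exp (c * t) • v t) + Real.exp (c * t) • w) t := by
  have he : HasDerivAt (fun s => Real.exp (c * s)) (Real.exp (c * t) * c) t := by
    simpa using ((hasDerivAt_id t).const_mul c).exp
  refine (he.smul hv).congr_deriv ?_
  rw [map_smul]
  module

/-- Skew-adjoint consequence (2.5) of Theorem 2.1 of the paper, bounded-operator form:
if `A` is skew-adjoint, the Riccati identity with `R = 0` holds and `λ₁ > 2λ`, then the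
coupled closed-loop system decays like `e^{-2λt}`. -/
theorem dynamic_feedback_linear_skewAdjoint_decay
    {H U : Type*} [NormedAddCommGroup H] [InnerProductSpace ℝ H] [CompleteSpace H]
    [NormedAddCommGroup U] [InnerProductSpace ℝ U] [CompleteSpace U]
    (A : H →L[ℝ] H) (B : U →L[ℝ] H) (W : U →L[ℝ] U) (Q Qinv : H →L[ℝ] H)
    (lam lam1 : ℝ)
    (hW : IsSelfAdjoint W) (hWnonneg : ∀ u : U, 0 ≤ ⟪W u, u⟫)
    (hQ : IsSelfAdjoint Q) (hQpos : ∃ c₀ > 0, ∀ x : H, c₀ * ‖x‖ ^ 2 ≤ ⟪Q x, x⟫)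
    (hQinv1 : Q ∘L Qinv = 1) (hQinv2 : Qinv ∘L Q = 1)
    (hRic : A ∘L Q + Q ∘L (adjoint A) - B ∘L W ∘L (adjoint B) + (2 * lam) • Q = 0)
    (hskew : adjoint A = -A)
    (hlam1 : lam1 > 2 * lam) :
    ∃ C > 0, ∀ y ytil : ℝ → H,
      (∀ t : ℝ, 0 ≤ t →
        HasDerivAt y (A (y t) - B (W (adjoint B (ytil t)))) t) →
      (∀ t : ℝ, 0 ≤ t →
        HasDerivAt ytil
          (-(adjoint A (ytil t)) - (2 * lam) • ytil t + lam1 • Qinv (y t - Q (ytil t))) t) →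
      ∀ t : ℝ, 0 ≤ t →
        ‖y t‖ + ‖ytil t‖ ≤ C * Real.exp (-(2 * lam) * t) * (‖y 0‖ + ‖ytil 0‖) := by
  set μ := lam1 - 2 * lam with hμ
  have hμpos : 0 < μ := sub_pos.mpr hlam1
  set M := |lam1| * ‖Qinv‖ / μ with hM
  have hM0 : 0 ≤ M := by positivity
  refine ⟨(1 + ‖Q‖) + (1 + ‖Q‖) * (1 + M * (1 + ‖Q‖)), by positivity, ?_⟩
  intro y ytil hy hytil t ht
  set z : ℝ → H := fun s => y s - Q (ytil s) with hz
  set S := ‖y 0‖ + ‖ytil 0‖ with hS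
  have hQQinv (x : H) : Q (Qinv x) = x := by simpa using DFunLike.congr_fun hQinv1 x
  have hz' : ∀ s, 0 ≤ s → HasDerivAt z (A (z s) - lam1 • z s + 0) s := by
    intro s hs
    refine ((hy s hs).sub (Q.hasFDerivAt.comp_hasDerivAt s (hytil s hs))).congr_deriv ?_
    have hRic' : A (Q (ytil s)) + Q (adjoint A (ytil s)) - B (W (adjoint B (ytil s)))
        + (2 * lam) • Q (ytil s) = 0 := by simpa using DFunLike.congr_fun hRic (ytil s)
    have hBW : B (W (adjoint B (ytil s))) = A (Q (ytil s)) + Q (adjoint A (ytil s))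
        + (2 * lam) • Q (ytil s) := by
      rw [eq_comm, ← sub_eq_zero, ← hRic']; abel
    rw [hBW]
    simp only [hz, map_add, map_sub, map_neg, map_smul, hQQinv]
    module
  have hz_exp : ∀ s, 0 ≤ s → ‖z s‖ ≤ Real.exp (-lam1 * s) * ‖z 0‖ := by
    intro s hs
    have h := norm_le_of_hasDerivAt_skewAdjoint_add hskew (g := fun _ => ‖z 0‖)
      (fun r hr => hasDerivAt_exp_smul_of_damped (hz' r hr))
      (fun r => hasDerivAt_const r _) (by simp) (by simp) hs
    rw [norm_smul, Real.norm_of_nonneg (Real.exp_pos _).le] at h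
    rw [neg_mul, Real.exp_neg, inv_mul_eq_div, le_div_iff₀' (Real.exp_pos _)]
    exact h
  have hz0 : ‖z 0‖ ≤ (1 + ‖Q‖) * S := by
    have h1 := norm_sub_le (y 0) (Q (ytil 0))
    have h2 := Q.le_opNorm (ytil 0)
    have h3 : 0 ≤ ‖Q‖ * ‖y 0‖ := by positivity
    simp only [hz, hS]
    linarith [norm_nonneg (ytil 0)]
  have hytil_exp : ‖ytil t‖ ≤ Real.exp (-(2 * lam) * t) * (‖ytil 0‖ + M * ‖z 0‖) := by
    have hg (s : ℝ) : HasDerivAt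
        (fun s => ‖ytil 0‖ + M * ‖z 0‖ * (1 - Real.exp (-μ * s)))
        (|lam1| * ‖Qinv‖ * ‖z 0‖ * Real.exp (-μ * s)) s := by
      have he : HasDerivAt (fun s => Real.exp (-μ * s)) (Real.exp (-μ * s) * -μ) s := by
        simpa using ((hasDerivAt_id s).const_mul (-μ)).exp
      refine (((he.const_sub 1).const_mul (M * ‖z 0‖)).const_add ‖ytil 0‖).congr_deriv ?_
      rw [hM]
      field_simp
    have hforce (s : ℝ) (hs : 0 ≤ s) : ‖Real.exp (2 * lam * s) • lam1 • Qinv (z s)‖ ≤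
        |lam1| * ‖Qinv‖ * ‖z 0‖ * Real.exp (-μ * s) := by
      rw [norm_smul, norm_smul, Real.norm_of_nonneg (Real.exp_pos _).le, Real.norm_eq_abs]
      calc Real.exp (2 * lam * s) * (|lam1| * ‖Qinv (z s)‖)
          ≤ Real.exp (2 * lam * s) * (|lam1| * (‖Qinv‖ * (Real.exp (-lam1 * s) * ‖z 0‖))) := by
            gcongr
            exact Qinv.le_opNorm_of_le (hz_exp s hs)
        _ = |lam1| * ‖Qinv‖ * ‖z 0‖ * (Real.exp (2 * lam * s) * Real.exp (-lam1 * s)) := by ring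
        _ = |lam1| * ‖Qinv‖ * ‖z 0‖ * Real.exp (-μ * s) := by
            rw [← Real.exp_add]; congr 2; rw [hμ]; ring
    have h := norm_le_of_hasDerivAt_skewAdjoint_add hskew
      (fun s hs => hasDerivAt_exp_smul_of_damped (A := A) (c := 2 * lam) (v := ytil)
        (w := lam1 • Qinv (z s)) (by simpa [hskew, hz] using hytil s hs))
      hg hforce (by simp) ht
    rw [norm_smul, Real.norm_of_nonneg (Real.exp_pos _).le] at h
    rw [neg_mul, Real.exp_neg, inv_mul_eq_div, le_div_iff₀' (Real.exp_pos _)]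
    refine h.trans ?_
    have h1 : 0 ≤ M * ‖z 0‖ * Real.exp (-μ * t) := by positivity
    linarith
  have hytil_le : ‖ytil t‖ ≤ Real.exp (-(2 * lam) * t) * ((1 + M * (1 + ‖Q‖)) * S) := by
    refine hytil_exp.trans ?_
    gcongr
    have h1 := mul_le_mul_of_nonneg_left hz0 hM0
    have h2 := norm_nonneg (y 0)
    linarith
  have hz_le : ‖z t‖ ≤ Real.exp (-(2 * lam) * t) * ((1 + ‖Q‖) * S) := by
    refine (hz_exp t ht).trans ?_
    gcongr
  have hy_le : ‖y t‖ ≤ ‖z t‖ + ‖Q‖ * ‖ytil t‖ := by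
    calc ‖y t‖ = ‖z t + Q (ytil t)‖ := by simp [hz]
      _ ≤ ‖z t‖ + ‖Q‖ * ‖ytil t‖ :=
        (norm_add_le _ _).trans (by gcongr; exact Q.le_opNorm _)
  have h := mul_le_mul_of_nonneg_left hytil_le (by positivity : 0 ≤ 1 + ‖Q‖)
  linarith
end

section
/- Assume the Riccati identity A∘Q + Q∘A* − B∘W∘B* + Q∘R∘Q + 2λ·Q = 0. Let y, ỹ : [0,∞) → H be differentiable functions satisfying, for all t ≥ 0, y′(t) = A y(t) − B W B* ỹ(t) and ỹ′(t) = −A* ỹ(t) − 2λ ỹ(t) − R Q ỹ(t), with initial condition ỹ(0) = Q⁻¹ y(0). Then ỹ(t) = Q⁻¹ y(t) for all t ≥ 0. -/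
open ContinuousLinearMap
open scoped RealInnerProductSpace

/-- Assertion (2.12) of the paper's Theorem 2.5, bounded-operator form: along the static
closed-loop system with `ỹ(0) = Q⁻¹ y(0)`, one has `ỹ(t) = Q⁻¹ y(t)` for all `t ≥ 0`. -/
theorem static_feedback_trajectory_identity
    {H U : Type*} [NormedAddCommGroup H] [InnerProductSpace ℝ H] [CompleteSpace H]
    [NormedAddCommGroup U] [InnerProductSpace ℝ U] [CompleteSpace U]
    (A : H →L[ℝ] H) (B : U →L[ℝ] H) (W : U →L[ℝ] U) (Q Qinv R : H →L[ℝ] H)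
    (lam : ℝ)
    (hW : IsSelfAdjoint W) (hWnonneg : ∀ u : U, 0 ≤ ⟪W u, u⟫)
    (hQ : IsSelfAdjoint Q) (hQpos : ∃ c₀ > 0, ∀ x : H, c₀ * ‖x‖ ^ 2 ≤ ⟪Q x, x⟫)
    (hQinv1 : Q ∘L Qinv = 1) (hQinv2 : Qinv ∘L Q = 1)
    (hR : IsSelfAdjoint R) (hRnonneg : ∀ x : H, 0 ≤ ⟪R x, x⟫)
    (hRic : A ∘L Q + Q ∘L (adjoint A) - B ∘L W ∘L (adjoint B) + Q ∘L R ∘L Q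
      + (2 * lam) • Q = 0)
    (y ytil : ℝ → H)
    (hy : ∀ t : ℝ, 0 ≤ t →
      HasDerivAt y (A (y t) - B (W (adjoint B (ytil t)))) t)
    (hytil : ∀ t : ℝ, 0 ≤ t →
      HasDerivAt ytil
        (-(adjoint A (ytil t)) - (2 * lam) • ytil t - R (Q (ytil t))) t)
    (hinit : ytil 0 = Qinv (y 0)) :
    ∀ t : ℝ, 0 ≤ t → ytil t = Qinv (y t) := by
  have hQQinv (x : H) : Q (Qinv x) = x := DFunLike.congr_fun hQinv1 x
  have hQinvQ (x : H) : Qinv (Q x) = x := DFunLike.congr_fun hQinv2 x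
  -- The defect `y - Q ỹ` solves the linear equation `z' = A z`.
  have hdefect (t : ℝ) (ht : 0 ≤ t) :
      HasDerivAt (fun s => y s - Q (ytil s)) (A (y t - Q (ytil t))) t := by
    refine ((hy t ht).sub (Q.hasFDerivAt.comp_hasDerivAt t (hytil t ht))).congr_deriv ?_
    have hRic_apply := DFunLike.congr_fun hRic (ytil t)
    simp only [_root_.add_apply, _root_.sub_apply,
      _root_.smul_apply, ContinuousLinearMap.comp_apply,
      _root_.zero_apply] at hRic_apply
    simp only [map_sub, map_neg, map_smul]
    rw [← sub_eq_zero, ← hRic_apply]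
    abel
  intro t ht
  have hzero : y t - Q (ytil t) = 0 :=
    eq_zero_of_abs_deriv_le_mul_abs_self_of_eq_zero_right (a := 0) (b := t)
      (HasDerivAt.continuousOn fun s hs => hdefect s hs.1)
      (fun s hs => (hdefect s hs.1).hasDerivWithinAt)
      (by simp [hinit, hQQinv]) (fun s _ => A.le_opNorm _) t ⟨ht, le_rfl⟩
  rw [sub_eq_zero.mp hzero, hQinvQ]
end

section
/- Assume the Riccati identity A∘Q + Q∘A* − B∘W∘B* + Q∘R∘Q + 2λ·Q = 0. Let y, ỹ : [0,∞) → H be differentiable functions satisfying, for all t ≥ 0, y′(t) = A y(t) − B W B* ỹ(t) and ỹ′(t) = −A* ỹ(t) − 2λ ỹ(t) − R Q ỹ(t), with initial condition ỹ(0) = Q⁻¹ y(0). Then for all t ≥ τ ≥ 0 one has the energy identity ⟨Q⁻¹ y(t), y(t)⟩ − ⟨Q⁻¹ y(τ), y(τ)⟩ = −2λ ∫_τ^t ⟨Q⁻¹ y(s), y(s)⟩ ds − ∫_τ^t ( ⟨W B* ỹ(s), B* ỹ(s)⟩ + ⟨R y(s), y(s)⟩ ) ds. -/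
open ContinuousLinearMap
open scoped RealInnerProductSpace

/-- A solution of `z' = A z` on `[0, ∞)` with `z 0 = 0` vanishes on `[0, ∞)`. -/
theorem eq_zero_of_hasDerivAt_clm_apply {E : Type*} [NormedAddCommGroup E] [NormedSpace ℝ E]
    (A : E →L[ℝ] E) {z : ℝ → E} (hz : ∀ t, 0 ≤ t → HasDerivAt z (A (z t)) t) (h0 : z 0 = 0)
    {t : ℝ} (ht : 0 ≤ t) : z t = 0 := by
  have hbound := norm_le_gronwallBound_of_norm_deriv_right_le (f := z) (f' := fun s => A (z s))
    (δ := 0) (K := ‖A‖) (ε := 0) (a := 0) (b := t)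
    (fun s hs => (hz s hs.1).continuousAt.continuousWithinAt)
    (fun s hs => (hz s hs.1).hasDerivWithinAt) (by simp [h0])
    (fun s _ => by simpa using A.le_opNorm (z s)) t ⟨ht, le_rfl⟩
  simpa [gronwallBound_ε0_δ0] using hbound

/-- Lyapunov identity (2.13) of the paper's Theorem 2.5, bounded-operator form: along the
static closed-loop system with `ỹ(0) = Q⁻¹ y(0)`, the energy `⟨Q⁻¹ y, y⟩` satisfies the
stated dissipation identity. -/
theorem static_feedback_energy_identity
    {H U : Type*} [NormedAddCommGroup H] [InnerProductSpace ℝ H] [CompleteSpace H]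
    [NormedAddCommGroup U] [InnerProductSpace ℝ U] [CompleteSpace U]
    (A : H →L[ℝ] H) (B : U →L[ℝ] H) (W : U →L[ℝ] U) (Q Qinv R : H →L[ℝ] H)
    (lam : ℝ)
    (hW : IsSelfAdjoint W) (hWnonneg : ∀ u : U, 0 ≤ ⟪W u, u⟫)
    (hQ : IsSelfAdjoint Q) (hQpos : ∃ c₀ > 0, ∀ x : H, c₀ * ‖x‖ ^ 2 ≤ ⟪Q x, x⟫)
    (hQinv1 : Q ∘L Qinv = 1) (hQinv2 : Qinv ∘L Q = 1)
    (hR : IsSelfAdjoint R) (hRnonneg : ∀ x : H, 0 ≤ ⟪R x, x⟫)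
    (hRic : A ∘L Q + Q ∘L (adjoint A) - B ∘L W ∘L (adjoint B) + Q ∘L R ∘L Q
      + (2 * lam) • Q = 0)
    (y ytil : ℝ → H)
    (hy : ∀ t : ℝ, 0 ≤ t →
      HasDerivAt y (A (y t) - B (W (adjoint B (ytil t)))) t)
    (hytil : ∀ t : ℝ, 0 ≤ t →
      HasDerivAt ytil
        (-(adjoint A (ytil t)) - (2 * lam) • ytil t - R (Q (ytil t))) t)
    (hinit : ytil 0 = Qinv (y 0)) :
    ∀ t τ : ℝ, 0 ≤ τ → τ ≤ t →
      ⟪Qinv (y t), y t⟫ - ⟪Qinv (y τ), y τ⟫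
        = -(2 * lam) * (∫ s in τ..t, ⟪Qinv (y s), y s⟫)
          - ∫ s in τ..t,
              (⟪W (adjoint B (ytil s)), adjoint B (ytil s)⟫ + ⟪R (y s), y s⟫) := by
  have hQy : ∀ s, 0 ≤ s → y s = Q (ytil s) := by
    intro s hs
    refine sub_eq_zero.mp (eq_zero_of_hasDerivAt_clm_apply A
      (z := fun r => y r - Q (ytil r)) (fun r hr => ?_) ?_ hs)
    · have hd := (hy r hr).sub (Q.hasFDerivAt.comp_hasDerivAt r (hytil r hr))
      refine hd.congr_deriv (sub_eq_zero.mp ?_)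
      have hric := DFunLike.congr_fun hRic (ytil r)
      simp only [add_apply, sub_apply, comp_apply, smul_apply, zero_apply] at hric
      rw [← hric]
      simp only [map_sub, map_neg, map_smul]
      abel
    · have h := DFunLike.congr_fun hQinv1 (y 0)
      simp only [comp_apply, one_apply_eq_self] at h
      simp [hinit, h]
  have hQinvy : ∀ s, 0 ≤ s → Qinv (y s) = ytil s := by
    intro s hs
    rw [hQy s hs]
    exact DFunLike.congr_fun hQinv2 (ytil s)
  intro t τ hτ hτt
  have hnonneg : ∀ s ∈ Set.uIcc τ t, 0 ≤ s := fun s hs => by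
    rw [Set.uIcc_of_le hτt] at hs
    exact hτ.trans hs.1
  have hcy : ContinuousOn y (Set.uIcc τ t) := fun s hs =>
    (hy s (hnonneg s hs)).continuousAt.continuousWithinAt
  have hcytil : ContinuousOn ytil (Set.uIcc τ t) := fun s hs =>
    (hytil s (hnonneg s hs)).continuousAt.continuousWithinAt
  have hderiv : ∀ s ∈ Set.uIcc τ t, HasDerivAt (fun r => ⟪ytil r, y r⟫)
      (-(2 * lam) * ⟪Qinv (y s), y s⟫
        - (⟪W (adjoint B (ytil s)), adjoint B (ytil s)⟫ + ⟪R (y s), y s⟫)) s := by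
    intro s hs
    have hs0 := hnonneg s hs
    refine ((hytil s hs0).inner ℝ (hy s hs0)).congr_deriv ?_
    rw [← hQy s hs0, hQinvy s hs0]
    simp only [inner_sub_left, inner_sub_right, inner_neg_left, real_inner_smul_left,
      adjoint_inner_left]
    rw [← adjoint_inner_left B, real_inner_comm (W _)]
    ring
  have hint₁ : IntervalIntegrable (fun s => -(2 * lam) * ⟪Qinv (y s), y s⟫)
      MeasureTheory.volume τ t :=
    ContinuousOn.intervalIntegrable (by fun_prop)
  have hint₂ : IntervalIntegrable
      (fun s => ⟪W (adjoint B (ytil s)), adjoint B (ytil s)⟫ + ⟪R (y s), y s⟫)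
      MeasureTheory.volume τ t :=
    ContinuousOn.intervalIntegrable (by fun_prop)
  rw [← intervalIntegral.integral_const_mul, ← intervalIntegral.integral_sub hint₁ hint₂,
    intervalIntegral.integral_eq_sub_of_hasDerivAt hderiv (hint₁.sub hint₂),
    hQinvy t (hτ.trans hτt), hQinvy τ hτ]
end

section
/- Assume the Riccati identity A∘Q + Q∘A* − B∘W∘B* + Q∘R∘Q + 2λ·Q = 0. Let y, ỹ : [0,∞) → H be differentiable functions satisfying, for all t ≥ 0, y′(t) = A y(t) − B W B* ỹ(t) and ỹ′(t) = −A* ỹ(t) − 2λ ỹ(t) − R Q ỹ(t), with initial condition ỹ(0) = Q⁻¹ y(0). Then ⟨Q⁻¹ y(t), y(t)⟩ ≤ e^{−2λt} ⟨Q⁻¹ y(0), y(0)⟩ for all t ≥ 0 (equivalently, ‖Q^{−1/2} y(t)‖ ≤ e^{−λt} ‖Q^{−1/2} y(0)‖). -/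
open ContinuousLinearMap
open scoped RealInnerProductSpace

/-- A solution of the linear equation `z' = A z` on `[0, ∞)` that starts at `0` vanishes. -/
theorem eq_zero_of_hasDerivAt_clm {E : Type*} [NormedAddCommGroup E] [NormedSpace ℝ E]
    (A : E →L[ℝ] E) {z : ℝ → E} (hz : ∀ t, 0 ≤ t → HasDerivAt z (A (z t)) t)
    (hz0 : z 0 = 0) {t : ℝ} (ht : 0 ≤ t) : z t = 0 :=
  eq_zero_of_abs_deriv_le_mul_abs_self_of_eq_zero_right (K := ‖A‖)
    (fun s hs => (hz s hs.1).continuousAt.continuousWithinAt)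
    (fun s hs => (hz s hs.1).hasDerivWithinAt) hz0
    (fun s _ => A.le_opNorm (z s)) t ⟨ht, le_rfl⟩

/-- A function on `[0, ∞)` with `f' ≤ c f` grows at most like `exp (c t)`. -/
theorem le_exp_mul_of_hasDerivAt_le {f f' : ℝ → ℝ} {c : ℝ}
    (hf : ∀ t, 0 ≤ t → HasDerivAt f (f' t) t) (hf' : ∀ t, 0 ≤ t → f' t ≤ c * f t)
    {t : ℝ} (ht : 0 ≤ t) : f t ≤ Real.exp (c * t) * f 0 := by
  have hg : ∀ s, 0 ≤ s → HasDerivAt (fun s => Real.exp (-(c * s)) * f s)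
      (Real.exp (-(c * s)) * (f' s - c * f s)) s := fun s hs => by
    have he := ((hasDerivAt_id' s).const_mul c).fun_neg.exp
    exact (he.fun_mul (hf s hs)).congr_deriv (by ring)
  have hanti : AntitoneOn (fun s => Real.exp (-(c * s)) * f s) (Set.Ici 0) := by
    refine antitoneOn_of_hasDerivWithinAt_nonpos (convex_Ici 0)
      (fun s hs => (hg s hs).continuousAt.continuousWithinAt)
      (fun s hs => (hg s (interior_subset hs)).hasDerivWithinAt) fun s hs => ?_
    exact mul_nonpos_of_nonneg_of_nonpos (Real.exp_pos _).le
      (sub_nonpos.2 (hf' s (interior_subset hs)))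
  have h := hanti Set.self_mem_Ici ht ht
  simp only [mul_zero, neg_zero, Real.exp_zero, one_mul] at h
  calc f t = Real.exp (c * t) * (Real.exp (-(c * t)) * f t) := by
        rw [← mul_assoc, ← Real.exp_add]; simp
    _ ≤ Real.exp (c * t) * f 0 := by gcongr

/-- Exponential decay (2.14) of the paper's Theorem 2.5, bounded-operator form: along the
static closed-loop system with `ỹ(0) = Q⁻¹ y(0)`, the energy `⟨Q⁻¹ y, y⟩` decays like
`e^{-2λt}`. -/
theorem static_feedback_exponential_decay
    {H U : Type*} [NormedAddCommGroup H] [InnerProductSpace ℝ H] [CompleteSpace H]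
    [NormedAddCommGroup U] [InnerProductSpace ℝ U] [CompleteSpace U]
    (A : H →L[ℝ] H) (B : U →L[ℝ] H) (W : U →L[ℝ] U) (Q Qinv R : H →L[ℝ] H)
    (lam : ℝ)
    (hW : IsSelfAdjoint W) (hWnonneg : ∀ u : U, 0 ≤ ⟪W u, u⟫)
    (hQ : IsSelfAdjoint Q) (hQpos : ∃ c₀ > 0, ∀ x : H, c₀ * ‖x‖ ^ 2 ≤ ⟪Q x, x⟫)
    (hQinv1 : Q ∘L Qinv = 1) (hQinv2 : Qinv ∘L Q = 1)
    (hR : IsSelfAdjoint R) (hRnonneg : ∀ x : H, 0 ≤ ⟪R x, x⟫)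
    (hRic : A ∘L Q + Q ∘L (adjoint A) - B ∘L W ∘L (adjoint B) + Q ∘L R ∘L Q
      + (2 * lam) • Q = 0)
    (y ytil : ℝ → H)
    (hy : ∀ t : ℝ, 0 ≤ t →
      HasDerivAt y (A (y t) - B (W (adjoint B (ytil t)))) t)
    (hytil : ∀ t : ℝ, 0 ≤ t →
      HasDerivAt ytil
        (-(adjoint A (ytil t)) - (2 * lam) • ytil t - R (Q (ytil t))) t)
    (hinit : ytil 0 = Qinv (y 0)) :
    ∀ t : ℝ, 0 ≤ t →
      ⟪Qinv (y t), y t⟫ ≤ Real.exp (-(2 * lam) * t) * ⟪Qinv (y 0), y 0⟫ := by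
  have hRic' : ∀ x, A (Q x) + Q (adjoint A x) - B (W (adjoint B x)) + Q (R (Q x))
      + (2 * lam) • Q x = 0 := fun x => by simpa using DFunLike.congr_fun hRic x
  have hQQinv : ∀ x, Q (Qinv x) = x := fun x => by simpa using DFunLike.congr_fun hQinv1 x
  have hQinvQ : ∀ x, Qinv (Q x) = x := fun x => by simpa using DFunLike.congr_fun hQinv2 x
  have hQsymm : ∀ u v, ⟪Q u, v⟫ = ⟪u, Q v⟫ := hQ.isSymmetric
  have hyQ : ∀ t, 0 ≤ t → y t = Q (ytil t) := fun t ht => by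
    refine sub_eq_zero.1 (eq_zero_of_hasDerivAt_clm A (z := fun s => y s - Q (ytil s))
      (fun s hs => ?_) (by simp [hinit, hQQinv]) ht)
    refine ((hy s hs).fun_sub
      (Q.hasFDerivAt.comp_hasDerivAt s (hytil s hs))).congr_deriv (sub_eq_zero.1 ?_)
    simp only [map_sub, map_neg, map_smul]
    rw [← hRic' (ytil s)]
    abel
  intro t ht
  have hE : ∀ s, 0 ≤ s → ⟪Qinv (y s), y s⟫ = ⟪ytil s, Q (ytil s)⟫ := fun s hs => by
    rw [hyQ s hs, hQinvQ]
  rw [hE t ht, hE 0 le_rfl]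
  refine le_exp_mul_of_hasDerivAt_le (f := fun s => ⟪ytil s, Q (ytil s)⟫)
    (fun s hs => (hytil s hs).inner ℝ (Q.hasFDerivAt.comp_hasDerivAt s (hytil s hs)))
    (fun s _ => ?_) ht
  have hRic_inner := congrArg (⟪·, ytil s⟫) (hRic' (ytil s))
  have hWs := hWnonneg (adjoint B (ytil s))
  have hRs := hRnonneg (Q (ytil s))
  have hAs : ⟪A (Q (ytil s)), ytil s⟫ = ⟪adjoint A (ytil s), Q (ytil s)⟫ := by
    rw [adjoint_inner_left, real_inner_comm]
  rw [adjoint_inner_right] at hWs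
  simp only [inner_add_left, inner_sub_left, real_inner_smul_left, inner_zero_left, hQsymm, hAs]
    at hRic_inner
  rw [real_inner_comm _ (ytil s), real_inner_comm _ (ytil s), hQsymm, hQsymm]
  simp only [inner_sub_left, real_inner_smul_left, inner_neg_left]
  linarith
end

section
/- Assume the Riccati identity with R = 0, i.e. A∘Q + Q∘A* − B∘W∘B* + 2λ·Q = 0, and assume A is skew-adjoint (A* = −A). Then there exist constants C₁ > 0 and C₂ > 0 (independent of the solution and of t) such that: for every pair of differentiable functions y, ỹ : [0,∞) → H satisfying, for all t ≥ 0, y′(t) = A y(t) − B W B* ỹ(t) and ỹ′(t) = −A* ỹ(t) − 2λ ỹ(t), with ỹ(0) = Q⁻¹ y(0), one has ỹ(t) = Q⁻¹ y(t) and C₁·e^{−2λt}·‖y(0)‖ ≤ ‖y(t)‖ ≤ C₂·e^{−2λt}·‖y(0)‖ for all t ≥ 0. -/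
open ContinuousLinearMap
open scoped RealInnerProductSpace

/-- Solutions of `dw/dt = A w + c w` with `A` skew-adjoint have norm exactly `e^{ct} ‖w 0‖`. -/
theorem norm_eq_exp_mul_of_hasDerivAt_skewAdjoint
    {H : Type*} [NormedAddCommGroup H] [InnerProductSpace ℝ H] [CompleteSpace H]
    {A : H →L[ℝ] H} (hskew : adjoint A = -A) (c : ℝ) {w : ℝ → H}
    (hw : ∀ t : ℝ, 0 ≤ t → HasDerivAt w (A (w t) + c • w t) t) {t : ℝ} (ht : 0 ≤ t) :
    ‖w t‖ = Real.exp (c * t) * ‖w 0‖ := by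
  have hA (x : H) : ⟪x, A x⟫ = 0 := by
    have h := adjoint_inner_left A x x
    rw [hskew, neg_apply, inner_neg_left, real_inner_comm] at h
    linarith
  have hderiv (s : ℝ) (hs : 0 ≤ s) :
      HasDerivAt (fun s => Real.exp (-(2 * c) * s) * ‖w s‖ ^ 2) 0 s := by
    have hexp := ((hasDerivAt_id s).const_mul (-(2 * c))).exp
    refine (hexp.mul (hw s hs).norm_sq).congr_deriv ?_
    simp only [inner_add_right, inner_smul_right, hA, real_inner_self_eq_norm_sq, id]
    ring
  have hconst := constant_of_has_deriv_right_zero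
    (fun s hs => (hderiv s hs.1).continuousAt.continuousWithinAt)
    (fun s hs => (hderiv s hs.1).hasDerivWithinAt) t (Set.right_mem_Icc.mpr ht)
  have hsq : ‖w t‖ ^ 2 = (Real.exp (c * t) * ‖w 0‖) ^ 2 := by
    have hmul : Real.exp (c * t) ^ 2 * Real.exp (-(2 * c) * t) = 1 := by
      rw [← Real.exp_nat_mul, ← Real.exp_add, Real.exp_eq_one_iff]
      push_cast
      ring
    simp only [mul_zero, Real.exp_zero, one_mul] at hconst
    rw [mul_pow, ← hconst, ← mul_assoc, hmul, one_mul]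
  exact (sq_eq_sq₀ (norm_nonneg _) (by positivity)).mp hsq

/-- Corollary 2.7 of the paper, bounded-operator form: if `A` is skew-adjoint and the
Riccati identity holds with `R = 0`, then along the static closed-loop system with
`ỹ(0) = Q⁻¹ y(0)` one has `ỹ(t) = Q⁻¹ y(t)` and two-sided exponential bounds
`C₁ e^{-2λt} ‖y(0)‖ ≤ ‖y(t)‖ ≤ C₂ e^{-2λt} ‖y(0)‖`. -/
theorem static_feedback_skewAdjoint_twoSided_decay
    {H U : Type*} [NormedAddCommGroup H] [InnerProductSpace ℝ H] [CompleteSpace H]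
    [NormedAddCommGroup U] [InnerProductSpace ℝ U] [CompleteSpace U]
    (A : H →L[ℝ] H) (B : U →L[ℝ] H) (W : U →L[ℝ] U) (Q Qinv : H →L[ℝ] H)
    (lam : ℝ)
    (hW : IsSelfAdjoint W) (hWnonneg : ∀ u : U, 0 ≤ ⟪W u, u⟫)
    (hQ : IsSelfAdjoint Q) (hQpos : ∃ c₀ > 0, ∀ x : H, c₀ * ‖x‖ ^ 2 ≤ ⟪Q x, x⟫)
    (hQinv1 : Q ∘L Qinv = 1) (hQinv2 : Qinv ∘L Q = 1)
    (hRic : A ∘L Q + Q ∘L (adjoint A) - B ∘L W ∘L (adjoint B) + (2 * lam) • Q = 0)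
    (hskew : adjoint A = -A) :
    ∃ C₁ > 0, ∃ C₂ > 0, ∀ y ytil : ℝ → H,
      (∀ t : ℝ, 0 ≤ t →
        HasDerivAt y (A (y t) - B (W (adjoint B (ytil t)))) t) →
      (∀ t : ℝ, 0 ≤ t →
        HasDerivAt ytil (-(adjoint A (ytil t)) - (2 * lam) • ytil t) t) →
      ytil 0 = Qinv (y 0) →
      ∀ t : ℝ, 0 ≤ t →
        ytil t = Qinv (y t) ∧
        C₁ * Real.exp (-(2 * lam) * t) * ‖y 0‖ ≤ ‖y t‖ ∧
        ‖y t‖ ≤ C₂ * Real.exp (-(2 * lam) * t) * ‖y 0‖ := by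
  have hQQinv (x : H) : Q (Qinv x) = x := DFunLike.congr_fun hQinv1 x
  have hQinvQ (x : H) : Qinv (Q x) = x := DFunLike.congr_fun hQinv2 x
  set K : ℝ := (‖Q‖ + 1) * (‖Qinv‖ + 1) with hK
  have hKpos : 0 < K := by positivity
  refine ⟨K⁻¹, inv_pos.mpr hKpos, K, hKpos, fun y ytil hy hytil h0 => ?_⟩
  have hdiff (s : ℝ) (hs : 0 ≤ s) : y s = Q (ytil s) := by
    have hz (r : ℝ) (hr : 0 ≤ r) : HasDerivAt (fun r => y r - Q (ytil r))
        (A (y r - Q (ytil r)) + (0 : ℝ) • (y r - Q (ytil r))) r := by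
      refine ((hy r hr).sub (Q.hasFDerivAt.comp_hasDerivAt r (hytil r hr))).congr_deriv ?_
      have hR := DFunLike.congr_fun hRic (ytil r)
      simp only [add_apply, sub_apply, comp_apply, smul_apply, zero_apply] at hR
      simp only [map_sub, map_neg, map_smul, zero_smul, add_zero]
      rw [← sub_eq_zero, ← hR]
      abel
    have hnorm := norm_eq_exp_mul_of_hasDerivAt_skewAdjoint hskew 0 hz hs
    simpa [h0, hQQinv, sub_eq_zero] using hnorm
  intro t ht
  have hinv (s : ℝ) (hs : 0 ≤ s) : ytil s = Qinv (y s) := by rw [hdiff s hs, hQinvQ]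
  have hnorm : ‖ytil t‖ = Real.exp (-(2 * lam) * t) * ‖ytil 0‖ :=
    norm_eq_exp_mul_of_hasDerivAt_skewAdjoint hskew (-(2 * lam))
      (fun s hs => by simpa [hskew, sub_eq_add_neg] using hytil s hs) ht
  have hyle (s : ℝ) (hs : 0 ≤ s) : ‖y s‖ ≤ (‖Q‖ + 1) * ‖ytil s‖ := by
    rw [hdiff s hs]
    exact Q.le_of_opNorm_le (by linarith) _
  have hytille (s : ℝ) (hs : 0 ≤ s) : ‖ytil s‖ ≤ (‖Qinv‖ + 1) * ‖y s‖ := by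
    rw [hinv s hs]
    exact Qinv.le_of_opNorm_le (by linarith) _
  refine ⟨hinv t ht, ?_, ?_⟩
  · rw [mul_assoc, inv_mul_le_iff₀ hKpos]
    calc Real.exp (-(2 * lam) * t) * ‖y 0‖
        ≤ Real.exp (-(2 * lam) * t) * ((‖Q‖ + 1) * ‖ytil 0‖) := by
          gcongr
          exact hyle 0 le_rfl
      _ = (‖Q‖ + 1) * ‖ytil t‖ := by rw [hnorm]; ring
      _ ≤ (‖Q‖ + 1) * ((‖Qinv‖ + 1) * ‖y t‖) := by
          gcongr
          exact hytille t ht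
      _ = K * ‖y t‖ := by rw [hK]; ring
  · calc ‖y t‖ ≤ (‖Q‖ + 1) * ‖ytil t‖ := hyle t ht
      _ = (‖Q‖ + 1) * (Real.exp (-(2 * lam) * t) * ‖ytil 0‖) := by rw [hnorm]
      _ ≤ (‖Q‖ + 1) * (Real.exp (-(2 * lam) * t) * ((‖Qinv‖ + 1) * ‖y 0‖)) := by
          gcongr
          exact hytille 0 le_rfl
      _ = K * Real.exp (-(2 * lam) * t) * ‖y 0‖ := by rw [hK]; ring
end

section
/- Assume the Riccati identity A∘Q + Q∘A* − B∘W∘B* + Q∘R∘Q + 2λ·Q = 0 with λ > 0. Then there exists ε > 0 such that: for every pair of differentiable functions y, ỹ : [0,∞) → H satisfying, for all t ≥ 0, y′(t) = A y(t) + f(y(t)) − B W B* ỹ(t) and ỹ′(t) = −A* ỹ(t) − 2λ ỹ(t) − R Q ỹ(t) + Q⁻¹ f(Q ỹ(t)), with ỹ(0) = Q⁻¹ y(0) and ‖y(0)‖ ≤ ε, one has ỹ(t) = Q⁻¹ y(t) for all t ≥ 0. -/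
open ContinuousLinearMap
open scoped RealInnerProductSpace

/-- Uniqueness with a local bound: if `‖d'‖ ≤ K ‖d‖` whenever `‖d‖` is below a threshold and
`d 0 = 0`, then `d` vanishes for all nonnegative times. -/
theorem eq_zero_of_norm_deriv_le_of_norm_lt {E : Type*} [NormedAddCommGroup E] [NormedSpace ℝ E]
    {d d' : ℝ → E} {K s : ℝ} (hs : 0 < s)
    (hd : ∀ t, 0 ≤ t → HasDerivAt d (d' t) t)
    (hbound : ∀ t, 0 ≤ t → ‖d t‖ < s → ‖d' t‖ ≤ K * ‖d t‖)
    (h0 : d 0 = 0) {T : ℝ} (hT : 0 ≤ T) : d T = 0 := by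
  have hle : ∀ a, 0 < a → a < s → ‖d T‖ ≤ a := by
    intro a ha has
    let L : ℝ := |K| + 1
    have hL : 0 < L := by positivity
    have hder : ∀ t, HasDerivAt (fun t => a * Real.exp (L * (t - T)))
        (L * (a * Real.exp (L * (t - T)))) t := by
      intro t
      refine ((((hasDerivAt_id' t).sub_const T).const_mul L).exp.const_mul a).congr_deriv ?_
      ring
    have key := image_norm_le_of_norm_deriv_right_lt_deriv_boundary (f := d) (f' := d')
      (a := 0) (b := T) (fun t ht => (hd t ht.1).continuousAt.continuousWithinAt)
      (fun t ht => (hd t ht.1).hasDerivWithinAt)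
      (B := fun t => a * Real.exp (L * (t - T)))
      (by simp only [h0, norm_zero]; positivity) hder
      (by
        intro t ht heq
        have hpos : 0 < ‖d t‖ := by rw [heq]; positivity
        have hlt : ‖d t‖ < s := by
          rw [heq]
          have : Real.exp (L * (t - T)) ≤ 1 :=
            Real.exp_le_one_iff.mpr
              (mul_nonpos_of_nonneg_of_nonpos hL.le (by linarith [ht.2]))
          nlinarith
        rw [← heq]
        have h1 := hbound t ht.1 hlt
        have h2 : K < L := by
          have := le_abs_self K
          simp only [L]
          linarith
        nlinarith)
    simpa using key (Set.right_mem_Icc.mpr hT)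
  rw [← norm_le_zero_iff]
  by_contra! hcon
  have h := hle (min (‖d T‖ / 2) (s / 2)) (by positivity)
    (lt_of_le_of_lt (min_le_right _ _) (by linarith))
  linarith [min_le_left (‖d T‖ / 2) (s / 2)]

section Riccati

variable {H U : Type*} [NormedAddCommGroup H] [InnerProductSpace ℝ H] [CompleteSpace H]
  [NormedAddCommGroup U] [InnerProductSpace ℝ U] [CompleteSpace U]
  {A Q R : H →L[ℝ] H} {B : U →L[ℝ] H} {W : U →L[ℝ] U} {lam : ℝ}

/-- The Riccati identity rewrites `Q` times the dual drift as the closed-loop drift. -/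
theorem map_dual_drift_of_riccati
    (hRic : A ∘L Q + Q ∘L (adjoint A) - B ∘L W ∘L (adjoint B) + Q ∘L R ∘L Q
      + (2 * lam) • Q = 0) (x : H) :
    Q (-(adjoint A x) - (2 * lam) • x - R (Q x)) = A (Q x) - B (W (adjoint B x)) := by
  have h := congrArg (fun T : H →L[ℝ] H => T x) hRic
  simp only [add_apply, sub_apply, smul_apply, comp_apply, zero_apply] at h
  rw [map_sub, map_sub, map_neg, map_smul, ← sub_eq_zero, ← neg_eq_zero, ← h]
  abel

/-- Dissipation inequality of the quadratic form of `Q` along the closed-loop drift. -/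
theorem inner_closed_loop_drift_le_of_riccati
    (hWnonneg : ∀ u : U, 0 ≤ ⟪W u, u⟫) (hQ : IsSelfAdjoint Q) (hRnonneg : ∀ x : H, 0 ≤ ⟪R x, x⟫)
    (hRic : A ∘L Q + Q ∘L (adjoint A) - B ∘L W ∘L (adjoint B) + Q ∘L R ∘L Q
      + (2 * lam) • Q = 0) (x : H) :
    ⟪A (Q x) - B (W (adjoint B x)), x⟫ ≤ -lam * ⟪Q x, x⟫ := by
  have hsymm : ∀ u v : H, ⟪Q u, v⟫ = ⟪u, Q v⟫ := hQ.isSymmetric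
  have h := congrArg (fun v => ⟪v, x⟫) (map_dual_drift_of_riccati hRic x)
  simp only [map_sub, map_neg, map_smul, inner_sub_left, inner_neg_left, real_inner_smul_left]
    at h
  have hA : ⟪Q (adjoint A x), x⟫ = ⟪A (Q x), x⟫ := by
    rw [hsymm, adjoint_inner_left, real_inner_comm]
  have hB : ⟪B (W (adjoint B x)), x⟫ = ⟪W (adjoint B x), adjoint B x⟫ := by
    rw [adjoint_inner_right]
  have hR' : ⟪Q (R (Q x)), x⟫ = ⟪R (Q x), Q x⟫ := hsymm _ _
  rw [inner_sub_left]
  rw [hA, hB, hR'] at h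
  rw [hB]
  linarith [hWnonneg (adjoint B x), hRnonneg (Q x)]

/-- If the quadratic form of a self-adjoint `Q` is strictly decreasing on its level `κ`
along a trajectory, then its sublevel set is forward invariant. -/
theorem quadratic_form_le_of_neg_on_level (hQ : IsSelfAdjoint Q) {x x' : ℝ → H} {κ : ℝ}
    (hx : ∀ t, 0 ≤ t → HasDerivAt x (x' t) t)
    (hneg : ∀ t, 0 ≤ t → ⟪Q (x t), x t⟫ = κ → ⟪Q (x' t), x t⟫ < 0)
    (h0 : ⟪Q (x 0), x 0⟫ ≤ κ) {t : ℝ} (ht : 0 ≤ t) : ⟪Q (x t), x t⟫ ≤ κ := by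
  have hV : ∀ t, 0 ≤ t →
      HasDerivAt (fun t => ⟪Q (x t), x t⟫) (2 * ⟪Q (x' t), x t⟫) t := by
    intro t ht
    refine ((Q.hasFDerivAt.comp_hasDerivAt t (hx t ht)).inner ℝ (hx t ht)).congr_deriv ?_
    have hsymm : ⟪Q (x t), x' t⟫ = ⟪x t, Q (x' t)⟫ := hQ.isSymmetric (x t) (x' t)
    rw [Function.comp_apply, hsymm, real_inner_comm (Q (x' t)) (x t)]
    ring
  exact image_le_of_deriv_right_lt_deriv_boundary (a := 0) (b := t) (B := fun _ => κ)
    (B' := fun _ => 0)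
    (fun s hs => (hV s hs.1).continuousAt.continuousWithinAt)
    (fun s hs => (hV s hs.1).hasDerivWithinAt) h0 (fun s => hasDerivAt_const s κ)
    (fun s hs heq => by linarith [hneg s hs.1 heq]) (Set.right_mem_Icc.mpr ht)

end Riccati

/-- Assertion (2.19) of the paper's nonlinear static feedback Theorem 2.10,
bounded-operator form: for `λ > 0` there is `ε > 0` such that along the nonlinear static
closed-loop system with `ỹ(0) = Q⁻¹ y(0)` and `‖y(0)‖ ≤ ε`, one has `ỹ(t) = Q⁻¹ y(t)`. -/
theorem nonlinear_static_feedback_trajectory_identity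
    {H U : Type*} [NormedAddCommGroup H] [InnerProductSpace ℝ H] [CompleteSpace H]
    [NormedAddCommGroup U] [InnerProductSpace ℝ U] [CompleteSpace U]
    (A : H →L[ℝ] H) (B : U →L[ℝ] H) (W : U →L[ℝ] U) (Q Qinv R : H →L[ℝ] H)
    (f : H → H) (lam : ℝ)
    (hW : IsSelfAdjoint W) (hWnonneg : ∀ u : U, 0 ≤ ⟪W u, u⟫)
    (hQ : IsSelfAdjoint Q) (hQpos : ∃ c₀ > 0, ∀ x : H, c₀ * ‖x‖ ^ 2 ≤ ⟪Q x, x⟫)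
    (hQinv1 : Q ∘L Qinv = 1) (hQinv2 : Qinv ∘L Q = 1)
    (hR : IsSelfAdjoint R) (hRnonneg : ∀ x : H, 0 ≤ ⟪R x, x⟫)
    (hRic : A ∘L Q + Q ∘L (adjoint A) - B ∘L W ∘L (adjoint B) + Q ∘L R ∘L Q
      + (2 * lam) • Q = 0)
    (hlam : 0 < lam)
    (hf1 : ∀ ε > (0:ℝ), ∃ δ > (0:ℝ), ∀ x : H, ‖x‖ ≤ δ → ‖f x‖ ≤ ε * ‖x‖)
    (hf2 : ∃ r > (0:ℝ), ∃ Λ > (0:ℝ), ∀ x y : H, ‖x‖ < r → ‖y‖ < r →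
      ‖f x - f y‖ ≤ Λ * ‖x - y‖) :
    ∃ ε > 0, ∀ y ytil : ℝ → H,
      (∀ t : ℝ, 0 ≤ t →
        HasDerivAt y (A (y t) + f (y t) - B (W (adjoint B (ytil t)))) t) →
      (∀ t : ℝ, 0 ≤ t →
        HasDerivAt ytil
          (-(adjoint A (ytil t)) - (2 * lam) • ytil t - R (Q (ytil t))
            + Qinv (f (Q (ytil t)))) t) →
      ytil 0 = Qinv (y 0) →
      ‖y 0‖ ≤ ε →
      ∀ t : ℝ, 0 ≤ t → ytil t = Qinv (y t) := by
  obtain ⟨c, hc, hcoer⟩ := hQpos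
  obtain ⟨r, hr, Λ, hΛ, hLip⟩ := hf2
  have hQQinv : ∀ x, Q (Qinv x) = x := fun x => by
    simpa using congrArg (fun T : H →L[ℝ] H => T x) hQinv1
  have hQinvQ : ∀ x, Qinv (Q x) = x := fun x => by
    simpa using congrArg (fun T : H →L[ℝ] H => T x) hQinv2
  let q : ℝ := ‖Q‖ + 1
  have hq : 0 < q := by positivity
  have hQle : ∀ x, ‖Q x‖ ≤ q * ‖x‖ := fun x =>
    Q.le_of_opNorm_le (by simp only [q]; linarith) x
  let p : ℝ := ‖Qinv‖ + 1
  have hp : 0 < p := by positivity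
  have hQinvle : ∀ x, ‖Qinv x‖ ≤ p * ‖x‖ := fun x =>
    Qinv.le_of_opNorm_le (by simp only [p]; linarith) x
  obtain ⟨δ, hδ, hfδ⟩ := hf1 (lam * c / (2 * q)) (by positivity)
  let ρ : ℝ := min δ (r / 2)
  have hρ : 0 < ρ := by positivity
  let κ : ℝ := c * (ρ / q) ^ 2
  have hκ : 0 < κ := by positivity
  have hsmall : ∀ x, ⟪Q x, x⟫ ≤ κ → ‖Q x‖ ≤ ρ := by
    intro x hx
    have h1 : ‖x‖ ^ 2 ≤ (ρ / q) ^ 2 := le_of_mul_le_mul_left ((hcoer x).trans hx) hc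
    have h2 : ‖x‖ ≤ ρ / q := le_of_sq_le_sq h1 (by positivity)
    calc ‖Q x‖ ≤ q * ‖x‖ := hQle x
      _ ≤ q * (ρ / q) := by gcongr
      _ = ρ := by field_simp
  refine ⟨√(κ / (q * p ^ 2)), by positivity, ?_⟩
  intro y ytil hy hytil h0 hy0
  have hκ0 : ⟪Q (ytil 0), ytil 0⟫ ≤ κ := by
    have h1 : ‖y 0‖ ^ 2 ≤ κ / (q * p ^ 2) :=
      (Real.le_sqrt (norm_nonneg _) (by positivity)).1 hy0
    calc ⟪Q (ytil 0), ytil 0⟫ ≤ ‖Q (ytil 0)‖ * ‖ytil 0‖ := real_inner_le_norm _ _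
      _ ≤ q * ‖ytil 0‖ * ‖ytil 0‖ := by gcongr; exact hQle _
      _ ≤ q * (p * ‖y 0‖) * (p * ‖y 0‖) := by rw [h0]; gcongr <;> exact hQinvle _
      _ = q * p ^ 2 * ‖y 0‖ ^ 2 := by ring
      _ ≤ q * p ^ 2 * (κ / (q * p ^ 2)) := by gcongr
      _ = κ := by field_simp
  have hdrift : ∀ t, Q (-(adjoint A (ytil t)) - (2 * lam) • ytil t - R (Q (ytil t))
      + Qinv (f (Q (ytil t)))) =
      A (Q (ytil t)) - B (W (adjoint B (ytil t))) + f (Q (ytil t)) := fun t => by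
    rw [map_add, map_dual_drift_of_riccati hRic, hQQinv]
  have hz : ∀ t, 0 ≤ t → ‖Q (ytil t)‖ ≤ ρ := fun t ht => by
    refine hsmall _ (quadratic_form_le_of_neg_on_level hQ hytil ?_ hκ0 ht)
    intro s _ heq
    rw [hdrift, inner_add_left]
    have h1 := inner_closed_loop_drift_le_of_riccati hWnonneg hQ hRnonneg hRic (ytil s)
    have h2 : ⟪f (Q (ytil s)), ytil s⟫ ≤ lam / 2 * κ :=
      calc ⟪f (Q (ytil s)), ytil s⟫ ≤ ‖f (Q (ytil s))‖ * ‖ytil s‖ := real_inner_le_norm _ _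
        _ ≤ lam * c / (2 * q) * (q * ‖ytil s‖) * ‖ytil s‖ := by
          gcongr
          refine (hfδ _ ((hsmall _ heq.le).trans (min_le_left _ _))).trans ?_
          gcongr
          exact hQle _
        _ = lam / 2 * (c * ‖ytil s‖ ^ 2) := by field_simp
        _ ≤ lam / 2 * κ := by
          rw [← heq]
          gcongr
          exact hcoer _
    rw [heq] at h1
    nlinarith
  intro T hT
  have hd : y T - Q (ytil T) = 0 := by
    refine eq_zero_of_norm_deriv_le_of_norm_lt (K := ‖A‖ + Λ) (half_pos hr)
      (d := fun t => y t - Q (ytil t))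
      (fun t ht => (hy t ht).sub (Q.hasFDerivAt.comp_hasDerivAt t (hytil t ht))) ?_ ?_ hT
    · intro t ht hlt
      have hzr : ‖Q (ytil t)‖ ≤ r / 2 := (hz t ht).trans (min_le_right _ _)
      have hyr : ‖y t‖ < r := by
        have := norm_add_le (y t - Q (ytil t)) (Q (ytil t))
        rw [sub_add_cancel] at this
        linarith
      rw [hdrift]
      have heq : A (y t) + f (y t) - B (W (adjoint B (ytil t))) -
          (A (Q (ytil t)) - B (W (adjoint B (ytil t))) + f (Q (ytil t))) =
          A (y t - Q (ytil t)) + (f (y t) - f (Q (ytil t))) := by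
        rw [map_sub]
        abel
      rw [heq, add_mul]
      exact (norm_add_le _ _).trans
        (add_le_add (A.le_opNorm _) (hLip _ _ hyr (by linarith)))
    · simp only [h0, hQQinv, sub_self]
  rw [sub_eq_zero.mp hd, hQinvQ]
end

section
/- Assume the Riccati identity A∘Q + Q∘A* − B∘W∘B* + Q∘R∘Q + 2λ·Q = 0 with λ > 0, and let 0 < γ < λ. Then there exists ε_γ > 0 such that: for every pair of differentiable functions y, ỹ : [0,∞) → H satisfying, for all t ≥ 0, y′(t) = A y(t) + f(y(t)) − B W B* ỹ(t) and ỹ′(t) = −A* ỹ(t) − 2λ ỹ(t) − R Q ỹ(t) + Q⁻¹ f(Q ỹ(t)), with ỹ(0) = Q⁻¹ y(0) and ‖y(0)‖ ≤ ε_γ, one has ⟨Q⁻¹ y(t), y(t)⟩ ≤ e^{−2γt} ⟨Q⁻¹ y(0), y(0)⟩ for all t ≥ 0 (equivalently, ‖Q^{−1/2} y(t)‖ ≤ e^{−γt} ‖Q^{−1/2} y(0)‖). -/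
open ContinuousLinearMap
open scoped RealInnerProductSpace

/-- If the derivative of `V` is at most `-(2 * γ) * V` whenever `V ≤ M`, and `V` starts below the
positive level `M`, then `V` never exceeds `M`, and it decays exponentially. -/
theorem le_and_le_exp_of_deriv_le_of_le {V V' : ℝ → ℝ} {γ M : ℝ} (hγ : 0 < γ) (hM : 0 < M)
    (hV : ∀ t, 0 ≤ t → HasDerivAt V (V' t) t) (h0 : V 0 ≤ M)
    (hV' : ∀ t, 0 ≤ t → V t ≤ M → V' t ≤ -(2 * γ) * V t) {T : ℝ} (hT : 0 ≤ T) :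
    V T ≤ M ∧ V T ≤ Real.exp (-(2 * γ) * T) * V 0 := by
  have hcont (T : ℝ) : ContinuousOn V (Set.Icc 0 T) := fun t ht =>
    (hV t ht.1).continuousAt.continuousWithinAt
  have hbound (t : ℝ) (ht : 0 ≤ t) : V t ≤ M := by
    refine image_le_of_deriv_right_lt_deriv_boundary (B := fun _ => M) (B' := fun _ => 0)
      (hcont t) (fun x hx => (hV x hx.1).hasDerivWithinAt) h0 (fun x => hasDerivAt_const x M)
      (fun x hx hxM => ?_) (Set.right_mem_Icc.2 ht)
    have hx' := hV' x hx.1 hxM.le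
    rw [hxM] at hx'
    have : 0 < γ * M := mul_pos hγ hM
    linarith
  refine ⟨hbound T hT, ?_⟩
  have hexp (t : ℝ) : HasDerivAt (fun t => Real.exp (2 * γ * t))
      (Real.exp (2 * γ * t) * (2 * γ)) t := by
    simpa using ((hasDerivAt_id t).const_mul (2 * γ)).exp
  have hweighted : Real.exp (2 * γ * T) * V T ≤ V 0 := by
    refine image_le_of_deriv_right_le_deriv_boundary (f := fun t => Real.exp (2 * γ * t) * V t)
      (B := fun _ => V 0) (B' := fun _ => 0) (a := 0) (b := T)
      (fun t ht => ((hexp t).mul (hV t ht.1)).continuousAt.continuousWithinAt)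
      (fun t ht => ((hexp t).mul (hV t ht.1)).hasDerivWithinAt) (by simp)
      continuousOn_const (fun t _ => hasDerivWithinAt_const t _ _)
      (fun t ht => ?_) (Set.right_mem_Icc.2 hT)
    have h := mul_le_mul_of_nonneg_left (hV' t ht.1 (hbound t ht.1))
      (Real.exp_pos (2 * γ * t)).le
    linarith
  calc V T = Real.exp (-(2 * γ) * T) * (Real.exp (2 * γ * T) * V T) := by
        rw [← mul_assoc, ← Real.exp_add]; simp
    _ ≤ Real.exp (-(2 * γ) * T) * V 0 :=
        mul_le_mul_of_nonneg_left hweighted (Real.exp_pos _).le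

/-- A function vanishing at `0` whose derivative is dominated by its norm, as long as that norm is
less than `ρ`, vanishes identically on `[0, ∞)`. -/
theorem eq_zero_of_norm_deriv_le_of_norm_lt_s8 {E : Type*} [NormedAddCommGroup E] [NormedSpace ℝ E]
    {w w' : ℝ → E} {K ρ : ℝ} (hK : 0 ≤ K) (hρ : 0 < ρ)
    (hw : ∀ t, 0 ≤ t → HasDerivAt w (w' t) t) (h0 : w 0 = 0)
    (hw' : ∀ t, 0 ≤ t → ‖w t‖ < ρ → ‖w' t‖ ≤ K * ‖w t‖) {T : ℝ} (hT : 0 ≤ T) : w T = 0 := by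
  have hsmall (ε : ℝ) (hε : 0 < ε) (hερ : ε < ρ) : ‖w T‖ ≤ ε := by
    have hB (t : ℝ) : HasDerivAt (fun t => ε * Real.exp ((K + 1) * (t - T)))
        (ε * (Real.exp ((K + 1) * (t - T)) * (K + 1))) t := by
      simpa using ((((hasDerivAt_id t).sub_const T).const_mul (K + 1)).exp).const_mul ε
    have h := image_norm_le_of_norm_deriv_right_lt_deriv_boundary (f := w) (f' := w')
      (a := 0) (b := T)
      (fun t ht => (hw t ht.1).continuousAt.continuousWithinAt)
      (fun t ht => (hw t ht.1).hasDerivWithinAt)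
      (by rw [h0, norm_zero]; positivity) hB
      (fun t ht hwt => ?_) (Set.right_mem_Icc.2 hT)
    · simpa using h
    · have hpos : 0 < ε * Real.exp ((K + 1) * (t - T)) := by positivity
      have hle : ε * Real.exp ((K + 1) * (t - T)) ≤ ε := by
        refine mul_le_of_le_one_right hε.le (Real.exp_le_one_iff.2 ?_)
        exact mul_nonpos_of_nonneg_of_nonpos (by linarith) (by linarith [ht.2])
      have := hw' t ht.1 (by linarith)
      rw [hwt] at this
      linarith
  refine norm_le_zero_iff.1 (le_of_forall_gt_imp_ge_of_dense fun ε hε => ?_)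
  exact (hsmall (min ε (ρ / 2)) (lt_min hε (half_pos hρ))
    ((min_le_right _ _).trans_lt (half_lt_self hρ))).trans (min_le_left _ _)

/-- The dissipation estimate provided by the Riccati identity. -/
theorem two_mul_inner_riccati_le
    {H U : Type*} [NormedAddCommGroup H] [InnerProductSpace ℝ H] [CompleteSpace H]
    [NormedAddCommGroup U] [InnerProductSpace ℝ U] [CompleteSpace U]
    {A : H →L[ℝ] H} {B : U →L[ℝ] H} {W : U →L[ℝ] U} {Q R : H →L[ℝ] H} {lam : ℝ}
    (hWnonneg : ∀ u : U, 0 ≤ ⟪W u, u⟫) (hQ : IsSelfAdjoint Q) (hRnonneg : ∀ x : H, 0 ≤ ⟪R x, x⟫)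
    (hRic : A ∘L Q + Q ∘L (adjoint A) - B ∘L W ∘L (adjoint B) + Q ∘L R ∘L Q
      + (2 * lam) • Q = 0) (x : H) :
    2 * ⟪A (Q x) - B (W (adjoint B x)), x⟫ ≤ -(2 * lam) * ⟪Q x, x⟫ := by
  have hsymm (u v : H) : ⟪Q u, v⟫ = ⟪u, Q v⟫ := hQ.isSymmetric u v
  have h := congrArg (fun T : H →L[ℝ] H => ⟪T x, x⟫) hRic
  simp only [add_apply, sub_apply, smul_apply, comp_apply, zero_apply, inner_add_left,
    inner_sub_left, inner_zero_left, real_inner_smul_left] at h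
  have hA : ⟪Q (adjoint A x), x⟫ = ⟪A (Q x), x⟫ := by
    rw [hsymm, adjoint_inner_left, real_inner_comm]
  have hB : ⟪B (W (adjoint B x)), x⟫ = ⟪W (adjoint B x), adjoint B x⟫ :=
    (adjoint_inner_right B _ _).symm
  rw [hsymm (R (Q x)), hA] at h
  rw [inner_sub_left]
  linarith [hWnonneg (adjoint B x), hRnonneg (Q x)]

/-- Decay assertion (2.21) of the paper's nonlinear static feedback Theorem 2.10,
bounded-operator form: for `0 < γ < λ` there is `ε_γ > 0` such that along the nonlinear
static closed-loop system with `ỹ(0) = Q⁻¹ y(0)` and `‖y(0)‖ ≤ ε_γ`, the energy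
`⟨Q⁻¹ y, y⟩` decays like `e^{-2γt}`. -/
theorem nonlinear_static_feedback_decay
    {H U : Type*} [NormedAddCommGroup H] [InnerProductSpace ℝ H] [CompleteSpace H]
    [NormedAddCommGroup U] [InnerProductSpace ℝ U] [CompleteSpace U]
    (A : H →L[ℝ] H) (B : U →L[ℝ] H) (W : U →L[ℝ] U) (Q Qinv R : H →L[ℝ] H)
    (f : H → H) (lam γ : ℝ)
    (hW : IsSelfAdjoint W) (hWnonneg : ∀ u : U, 0 ≤ ⟪W u, u⟫)
    (hQ : IsSelfAdjoint Q) (hQpos : ∃ c₀ > 0, ∀ x : H, c₀ * ‖x‖ ^ 2 ≤ ⟪Q x, x⟫)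
    (hQinv1 : Q ∘L Qinv = 1) (hQinv2 : Qinv ∘L Q = 1)
    (hR : IsSelfAdjoint R) (hRnonneg : ∀ x : H, 0 ≤ ⟪R x, x⟫)
    (hRic : A ∘L Q + Q ∘L (adjoint A) - B ∘L W ∘L (adjoint B) + Q ∘L R ∘L Q
      + (2 * lam) • Q = 0)
    (hlam : 0 < lam) (hγ : 0 < γ) (hγlam : γ < lam)
    (hf1 : ∀ ε > (0:ℝ), ∃ δ > (0:ℝ), ∀ x : H, ‖x‖ ≤ δ → ‖f x‖ ≤ ε * ‖x‖)
    (hf2 : ∃ r > (0:ℝ), ∃ Λ > (0:ℝ), ∀ x y : H, ‖x‖ < r → ‖y‖ < r →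
      ‖f x - f y‖ ≤ Λ * ‖x - y‖) :
    ∃ εγ > 0, ∀ y ytil : ℝ → H,
      (∀ t : ℝ, 0 ≤ t →
        HasDerivAt y (A (y t) + f (y t) - B (W (adjoint B (ytil t)))) t) →
      (∀ t : ℝ, 0 ≤ t →
        HasDerivAt ytil
          (-(adjoint A (ytil t)) - (2 * lam) • ytil t - R (Q (ytil t))
            + Qinv (f (Q (ytil t)))) t) →
      ytil 0 = Qinv (y 0) →
      ‖y 0‖ ≤ εγ →
      ∀ t : ℝ, 0 ≤ t →
        ⟪Qinv (y t), y t⟫ ≤ Real.exp (-(2 * γ) * t) * ⟪Qinv (y 0), y 0⟫ := by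
  obtain ⟨c, hc, hQc⟩ := hQpos
  obtain ⟨r, hr, Λ, hΛ, hLip⟩ := hf2
  have hq : 0 < ‖Q‖ + 1 := by positivity
  obtain ⟨δ, hδ, hfδ⟩ := hf1 ((lam - γ) * c / (‖Q‖ + 1)) (by
    have := sub_pos.2 hγlam
    positivity)
  have hp : 0 < ‖Qinv‖ + 1 := by positivity
  set σ := min δ (r / 4)
  have hσ : 0 < σ := lt_min hδ (by linarith)
  set M := c * (σ / (‖Q‖ + 1)) ^ 2
  have hM : 0 < M := by positivity
  have hQsmall (x : H) (hx : ⟪Q x, x⟫ ≤ M) : ‖Q x‖ ≤ σ := by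
    have h : ‖x‖ ^ 2 ≤ (σ / (‖Q‖ + 1)) ^ 2 := le_of_mul_le_mul_left ((hQc x).trans hx) hc
    have hx : ‖x‖ ≤ σ / (‖Q‖ + 1) := le_of_sq_le_sq h (by positivity)
    rw [le_div_iff₀ hq] at hx
    linarith [Q.le_opNorm x, norm_nonneg x]
  refine ⟨√(M / (‖Qinv‖ + 1)), by positivity, fun y ytil hy hytil hinit hsmall => ?_⟩
  have hQQinv (x : H) : Q (Qinv x) = x := congrArg (fun T : H →L[ℝ] H => T x) hQinv1
  have hQinvQ (x : H) : Qinv (Q x) = x := congrArg (fun T : H →L[ℝ] H => T x) hQinv2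
  have hz (t : ℝ) (ht : 0 ≤ t) : HasDerivAt (fun t => Q (ytil t))
      (A (Q (ytil t)) - B (W (adjoint B (ytil t))) + f (Q (ytil t))) t := by
    refine (Q.hasFDerivAt.comp_hasDerivAt t (hytil t ht)).congr_deriv ?_
    have h := congrArg (fun T : H →L[ℝ] H => T (ytil t)) hRic
    simp only [add_apply, sub_apply, smul_apply, comp_apply, zero_apply] at h
    simp only [map_add, map_sub, map_neg, map_smul, hQQinv]
    rw [eq_comm, ← sub_eq_zero, ← h]
    abel
  have hsymm (u v : H) : ⟪Q u, v⟫ = ⟪u, Q v⟫ := hQ.isSymmetric u v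
  have hV (t : ℝ) (ht : 0 ≤ t) : HasDerivAt (fun t => ⟪Q (ytil t), ytil t⟫)
      (2 * ⟪A (Q (ytil t)) - B (W (adjoint B (ytil t))) + f (Q (ytil t)), ytil t⟫) t := by
    refine ((hz t ht).inner ℝ (hytil t ht)).congr_deriv ?_
    rw [hsymm, (Q.hasFDerivAt.comp_hasDerivAt t (hytil t ht)).unique (hz t ht),
      real_inner_comm]
    ring
  have hV0 : ⟪Q (ytil 0), ytil 0⟫ = ⟪Qinv (y 0), y 0⟫ := by
    rw [hinit, hQQinv, real_inner_comm]
  have hV0M : ⟪Q (ytil 0), ytil 0⟫ ≤ M := by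
    rw [hV0]
    have hsq : ‖y 0‖ ^ 2 ≤ M / (‖Qinv‖ + 1) := by
      rw [← Real.sq_sqrt (show 0 ≤ M / (‖Qinv‖ + 1) by positivity)]
      gcongr
    rw [le_div_iff₀ hp] at hsq
    calc ⟪Qinv (y 0), y 0⟫ ≤ ‖Qinv (y 0)‖ * ‖y 0‖ := real_inner_le_norm _ _
      _ ≤ ‖Qinv‖ * ‖y 0‖ * ‖y 0‖ := by gcongr; exact Qinv.le_opNorm _
      _ ≤ M := by linarith [sq_nonneg ‖y 0‖]
  have hdecay (t : ℝ) (ht : 0 ≤ t) := le_and_le_exp_of_deriv_le_of_le hγ hM hV hV0M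
    (fun s _ hs => by
      set x := ytil s
      have hf := hfδ (Q x) ((hQsmall x hs).trans (min_le_left _ _))
      have hfx : ⟪f (Q x), x⟫ ≤ (lam - γ) * ⟪Q x, x⟫ := by
        have hlg := sub_pos.2 hγlam
        calc ⟪f (Q x), x⟫ ≤ ‖f (Q x)‖ * ‖x‖ := real_inner_le_norm _ _
          _ ≤ (lam - γ) * c / (‖Q‖ + 1) * ((‖Q‖ + 1) * ‖x‖) * ‖x‖ := by
            gcongr
            refine hf.trans ?_
            gcongr
            linarith [Q.le_opNorm x, norm_nonneg x]
          _ = (lam - γ) * (c * ‖x‖ ^ 2) := by field_simp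
          _ ≤ (lam - γ) * ⟪Q x, x⟫ := mul_le_mul_of_nonneg_left (hQc x) hlg.le
      have := two_mul_inner_riccati_le hWnonneg hQ hRnonneg hRic x
      rw [inner_add_left]
      linarith) ht
  intro t ht
  have hyz : y t - Q (ytil t) = 0 := by
    refine eq_zero_of_norm_deriv_le_of_norm_lt_s8 (w := fun t => y t - Q (ytil t))
      (K := ‖A‖ + Λ) (ρ := r / 2) (by positivity) (half_pos hr)
      (fun s hs => (hy s hs).sub (hz s hs)) (by rw [hinit, hQQinv, sub_self])
      (fun s hs hws => ?_) ht
    have hzs : ‖Q (ytil s)‖ ≤ r / 4 :=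
      (hQsmall _ (hdecay s hs).1).trans (min_le_right _ _)
    have hys : ‖y s‖ < r := by
      have := norm_le_norm_add_norm_sub' (y s) (Q (ytil s))
      linarith
    have heq : A (y s) + f (y s) - B (W (adjoint B (ytil s)))
        - (A (Q (ytil s)) - B (W (adjoint B (ytil s))) + f (Q (ytil s)))
        = A (y s - Q (ytil s)) + (f (y s) - f (Q (ytil s))) := by
      rw [map_sub]
      abel
    rw [heq, add_mul]
    exact norm_add_le_of_le (A.le_opNorm _) (hLip _ _ hys (by linarith))
  have hdt := (hdecay t ht).2
  rw [sub_eq_zero.1 hyz, hQinvQ, real_inner_comm, ← hV0]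
  exact hdt
end

section
/- Assume the Riccati identity with R = 0, i.e. A∘Q + Q∘A* − B∘W∘B* + 2λ·Q = 0 with λ > 0, and assume A is skew-adjoint (A* = −A). Let 0 < γ < λ. Then there exist ε > 0 and C > 0 such that: for every pair of differentiable functions y, ỹ : [0,∞) → H satisfying, for all t ≥ 0, y′(t) = A y(t) + f(y(t)) − B W B* ỹ(t) and ỹ′(t) = −A* ỹ(t) − 2λ ỹ(t) + Q⁻¹ f(Q ỹ(t)), with ỹ(0) = Q⁻¹ y(0) and ‖y(0)‖ ≤ ε, one has ỹ(t) = Q⁻¹ y(t) and ‖y(t)‖ ≤ C·e^{−2γt}·‖y(0)‖ for all t ≥ 0. -/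
open ContinuousLinearMap
open scoped RealInnerProductSpace

/-- If `x` satisfies the strict dissipation inequality `⟪x, x'⟫ < -a ‖x‖²` as long as it stays in
the closed ball of radius `ρ`, then starting in this ball it decays like `e^{-at}`. -/
lemma norm_le_exp_mul_of_inner_deriv_lt {E : Type*} [NormedAddCommGroup E] [InnerProductSpace ℝ E]
    {x x' : ℝ → E} {a ρ : ℝ} (ha : 0 ≤ a) (hρ : 0 < ρ)
    (hx : ∀ t, 0 ≤ t → HasDerivAt x (x' t) t)
    (hdiss : ∀ t, 0 ≤ t → x t ≠ 0 → ‖x t‖ ≤ ρ → ⟪x t, x' t⟫ < -a * ‖x t‖ ^ 2)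
    (hx0 : ‖x 0‖ ≤ ρ) {t : ℝ} (ht : 0 ≤ t) :
    ‖x t‖ ≤ Real.exp (-a * t) * ‖x 0‖ := by
  have fence : ∀ c, 0 < c → ‖x 0‖ ≤ c → c ≤ ρ → ‖x t‖ ≤ Real.exp (-a * t) * c := by
    intro c hc hxc hcρ
    have hB : ∀ s, HasDerivAt (fun s => (Real.exp (-a * s) * c) ^ 2)
        (-(2 * a) * (Real.exp (-a * s) * c) ^ 2) s := by
      intro s
      have h := ((((hasDerivAt_id s).const_mul (-a)).exp).mul_const c).pow 2
      refine h.congr_deriv ?_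
      simp only [id]
      push_cast
      ring
    have key := image_le_of_deriv_right_lt_deriv_boundary (a := 0) (b := t)
      (f := fun s => ‖x s‖ ^ 2) (f' := fun s => 2 * ⟪x s, x' s⟫)
      (fun s hs => (hx s hs.1).norm_sq.continuousAt.continuousWithinAt)
      (fun s hs => (hx s hs.1).norm_sq.hasDerivWithinAt)
      (B := fun s => (Real.exp (-a * s) * c) ^ 2)
      (by simpa using pow_le_pow_left₀ (norm_nonneg _) hxc 2) hB
      (by
        intro s hs heq
        have hpos : 0 < Real.exp (-a * s) * c := by positivity
        have hnorm : ‖x s‖ = Real.exp (-a * s) * c :=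
          (sq_eq_sq₀ (norm_nonneg _) hpos.le).1 heq
        have hexp : Real.exp (-a * s) ≤ 1 := Real.exp_le_one_iff.2 (by nlinarith [hs.1])
        have hd := hdiss s hs.1 (norm_pos_iff.1 (hnorm ▸ hpos)) (by rw [hnorm]; nlinarith)
        rw [hnorm] at hd
        linarith)
    exact (sq_le_sq₀ (norm_nonneg _) (by positivity)).1 (key (Set.right_mem_Icc.2 ht))
  rcases (norm_nonneg (x 0)).eq_or_lt with h0 | h0
  · by_contra! hlt
    rw [← h0, mul_zero] at hlt
    have hexp : Real.exp (-a * t) ≤ 1 := Real.exp_le_one_iff.2 (by nlinarith)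
    have hmin : 0 < min ρ (‖x t‖ / 2) := lt_min hρ (by linarith)
    have h := fence _ hmin (h0 ▸ hmin.le) (min_le_left _ _)
    nlinarith [min_le_right ρ (‖x t‖ / 2)]
  · exact fence _ h0 le_rfl hx0

/-- Forward uniqueness for an ODE whose right-hand side is Lipschitz on an open set `s`, where only
one of the two solutions is known to stay in `s`. -/
lemma ODE_solution_unique_of_mem_isOpen {E : Type*} [NormedAddCommGroup E] [NormedSpace ℝ E]
    {v : ℝ → E → E} {s : Set E} {K : NNReal} {y z : ℝ → E} (hs : IsOpen s)
    (hv : ∀ t, 0 ≤ t → LipschitzOnWith K (v t) s)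
    (hy : ∀ t, 0 ≤ t → HasDerivAt y (v t (y t)) t)
    (hz : ∀ t, 0 ≤ t → HasDerivAt z (v t (z t)) t)
    (hzs : ∀ t, 0 ≤ t → z t ∈ s) (h0 : y 0 = z 0) {t : ℝ} (ht : 0 ≤ t) :
    y t = z t := by
  have hsub : Set.Icc 0 t ⊆ {τ | y τ = z τ} := by
    refine IsClosed.Icc_subset_of_forall_exists_gt ?_ h0 ?_
    · have hcont : ContinuousOn (fun τ => y τ - z τ) (Set.Icc 0 t) := fun τ hτ =>
        ((hy τ hτ.1).continuousAt.sub (hz τ hτ.1).continuousAt).continuousWithinAt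
      convert hcont.preimage_isClosed_of_isClosed isClosed_Icc (isClosed_singleton (x := 0)) using 1
      ext τ
      simp [sub_eq_zero, and_comm]
    · rintro τ ⟨hτ, hτ0, -⟩ b hb
      have hmem : y τ ∈ s := by
        rw [show y τ = z τ from hτ]
        exact hzs τ hτ0
      obtain ⟨d, hd, hball⟩ := Metric.eventually_nhds_iff.1
        ((hy τ hτ0).continuousAt.eventually (hs.mem_nhds hmem))
      have hτb : τ < b := hb
      have hlt : τ < min b (τ + d) := lt_min hτb (by linarith)
      have heq := ODE_solution_unique_of_mem_Icc_right (a := τ) (b := min b (τ + d))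
        (s := fun _ => s) (fun u hu => hv u (hτ0.trans hu.1))
        (fun u hu => (hy u (hτ0.trans hu.1)).continuousAt.continuousWithinAt)
        (fun u hu => (hy u (hτ0.trans hu.1)).hasDerivWithinAt)
        (fun u hu => hball (by
          have := hu.2.trans_le (min_le_right _ _)
          rw [Real.dist_eq, abs_of_nonneg (by linarith [hu.1])]
          linarith))
        (fun u hu => (hz u (hτ0.trans hu.1)).continuousAt.continuousWithinAt)
        (fun u hu => (hz u (hτ0.trans hu.1)).hasDerivWithinAt)
        (fun u hu => hzs u (hτ0.trans hu.1)) hτ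
      exact ⟨min b (τ + d), heq (Set.right_mem_Icc.2 hlt.le), hlt, min_le_left _ _⟩
  exact hsub (Set.right_mem_Icc.2 ht)

/-- Corollary 2.12 of the paper, bounded-operator form: if `A` is skew-adjoint, the
Riccati identity holds with `R = 0` and `λ > 0`, then for `0 < γ < λ` small solutions of
the nonlinear static closed-loop system satisfy `ỹ(t) = Q⁻¹ y(t)` and decay like
`e^{-2γt}`. -/
theorem nonlinear_static_feedback_skewAdjoint_decay
    {H U : Type*} [NormedAddCommGroup H] [InnerProductSpace ℝ H] [CompleteSpace H]
    [NormedAddCommGroup U] [InnerProductSpace ℝ U] [CompleteSpace U]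
    (A : H →L[ℝ] H) (B : U →L[ℝ] H) (W : U →L[ℝ] U) (Q Qinv : H →L[ℝ] H)
    (f : H → H) (lam γ : ℝ)
    (hW : IsSelfAdjoint W) (hWnonneg : ∀ u : U, 0 ≤ ⟪W u, u⟫)
    (hQ : IsSelfAdjoint Q) (hQpos : ∃ c₀ > 0, ∀ x : H, c₀ * ‖x‖ ^ 2 ≤ ⟪Q x, x⟫)
    (hQinv1 : Q ∘L Qinv = 1) (hQinv2 : Qinv ∘L Q = 1)
    (hRic : A ∘L Q + Q ∘L (adjoint A) - B ∘L W ∘L (adjoint B) + (2 * lam) • Q = 0)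
    (hskew : adjoint A = -A)
    (hlam : 0 < lam) (hγ : 0 < γ) (hγlam : γ < lam)
    (hf1 : ∀ ε > (0:ℝ), ∃ δ > (0:ℝ), ∀ x : H, ‖x‖ ≤ δ → ‖f x‖ ≤ ε * ‖x‖)
    (hf2 : ∃ r > (0:ℝ), ∃ Λ > (0:ℝ), ∀ x y : H, ‖x‖ < r → ‖y‖ < r →
      ‖f x - f y‖ ≤ Λ * ‖x - y‖) :
    ∃ ε > 0, ∃ C > 0, ∀ y ytil : ℝ → H,
      (∀ t : ℝ, 0 ≤ t →
        HasDerivAt y (A (y t) + f (y t) - B (W (adjoint B (ytil t)))) t) →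
      (∀ t : ℝ, 0 ≤ t →
        HasDerivAt ytil
          (-(adjoint A (ytil t)) - (2 * lam) • ytil t + Qinv (f (Q (ytil t)))) t) →
      ytil 0 = Qinv (y 0) →
      ‖y 0‖ ≤ ε →
      ∀ t : ℝ, 0 ≤ t →
        ytil t = Qinv (y t) ∧ ‖y t‖ ≤ C * Real.exp (-(2 * γ) * t) * ‖y 0‖ := by
  obtain ⟨r, hr, Λ, hΛ, hLip⟩ := hf2
  have hQ1 : ∀ x, Q (Qinv x) = x := fun x => by simpa using DFunLike.congr_fun hQinv1 x
  have hQ2 : ∀ x, Qinv (Q x) = x := fun x => by simpa using DFunLike.congr_fun hQinv2 x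
  have hA : ∀ x, ⟪x, A x⟫ = 0 := by
    intro x
    have h := adjoint_inner_left A x x
    rw [hskew, neg_apply, inner_neg_left, real_inner_comm] at h
    linarith
  set Mq := ‖Q‖ + 1 with hMq
  set Mi := ‖Qinv‖ + 1 with hMi
  have hMq0 : 0 < Mq := by positivity
  have hMi0 : 0 < Mi := by positivity
  have hQn : ∀ x, ‖Q x‖ ≤ Mq * ‖x‖ := fun x => Q.le_of_opNorm_le (by linarith) x
  have hQin : ∀ x, ‖Qinv x‖ ≤ Mi * ‖x‖ := fun x => Qinv.le_of_opNorm_le (by linarith) x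
  have hgap : 0 < lam - γ := by linarith
  obtain ⟨δ, hδ, hfδ⟩ := hf1 ((lam - γ) / (Mi * Mq)) (by positivity)
  set ρ := min δ (r / 2) / Mq
  have hρ : 0 < ρ := by positivity
  have hQρ : ∀ x, ‖x‖ ≤ ρ → ‖Q x‖ ≤ min δ (r / 2) := fun x hx =>
    (hQn x).trans (by rw [mul_comm]; exact (le_div_iff₀ hMq0).1 hx)
  refine ⟨ρ / Mi, by positivity, Mq * Mi, by positivity, ?_⟩
  intro y ytil hy hytil h0 hy0
  have hyt0 : ‖ytil 0‖ ≤ Mi * ‖y 0‖ := h0 ▸ hQin (y 0)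
  have hyt0ρ : ‖ytil 0‖ ≤ ρ := hyt0.trans (by rw [mul_comm]; exact (le_div_iff₀ hMi0).1 hy0)
  have hdecay : ∀ t, 0 ≤ t → ‖ytil t‖ ≤ Real.exp (-(2 * γ) * t) * ‖ytil 0‖ := by
    intro t ht
    refine norm_le_exp_mul_of_inner_deriv_lt (by positivity) hρ hytil ?_ hyt0ρ ht
    intro s _ hne hsρ
    have hpert : ‖Qinv (f (Q (ytil s)))‖ ≤ (lam - γ) * ‖ytil s‖ := calc
      _ ≤ Mi * ‖f (Q (ytil s))‖ := hQin _
      _ ≤ Mi * ((lam - γ) / (Mi * Mq) * (Mq * ‖ytil s‖)) := by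
        gcongr
        exact (hfδ _ ((hQρ _ hsρ).trans (min_le_left _ _))).trans (by gcongr; exact hQn _)
      _ = (lam - γ) * ‖ytil s‖ := by field_simp
    have hcs := real_inner_le_norm (ytil s) (Qinv (f (Q (ytil s))))
    have hpos : 0 < ‖ytil s‖ := norm_pos_iff.2 hne
    rw [hskew, neg_apply, neg_neg, inner_add_right, inner_sub_right, hA, inner_smul_right,
      real_inner_self_eq_norm_sq]
    nlinarith [mul_le_mul_of_nonneg_left hpert hpos.le, mul_pos hgap (pow_pos hpos 2)]
  have hsmall : ∀ t, 0 ≤ t → Q (ytil t) ∈ Metric.ball (0 : H) r := by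
    intro t ht
    have hexp : Real.exp (-(2 * γ) * t) ≤ 1 := Real.exp_le_one_iff.2 (by nlinarith)
    have hle : ‖ytil t‖ ≤ ρ :=
      (hdecay t ht).trans ((mul_le_of_le_one_left (norm_nonneg _) hexp).trans hyt0ρ)
    rw [mem_ball_zero_iff]
    linarith [hQρ _ hle, min_le_right δ (r / 2)]
  have hyQ : ∀ t, 0 ≤ t → y t = Q (ytil t) := by
    intro t ht
    refine ODE_solution_unique_of_mem_isOpen
      (v := fun t x => A x + f x - B (W (adjoint B (ytil t)))) (K := ‖A‖₊ + Λ.toNNReal)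
      (z := fun t => Q (ytil t)) Metric.isOpen_ball ?_ hy ?_ hsmall (by simp [h0, hQ1]) ht
    · intro s _
      refine lipschitzOnWith_iff_norm_sub_le.2 fun u hu w hw => ?_
      have hf := hLip u w (mem_ball_zero_iff.1 hu) (mem_ball_zero_iff.1 hw)
      have hsplit : A u + f u - B (W (adjoint B (ytil s))) -
          (A w + f w - B (W (adjoint B (ytil s)))) = A (u - w) + (f u - f w) := by
        rw [map_sub]
        abel
      rw [hsplit]
      refine (norm_add_le _ _).trans ?_
      have hAuw := A.le_opNorm (u - w)
      simp only [NNReal.coe_add, coe_nnnorm, Real.coe_toNNReal _ hΛ.le]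
      linarith
    · intro s hs
      refine (Q.hasFDerivAt.comp_hasDerivAt s (hytil s hs)).congr_deriv ?_
      have hR := DFunLike.congr_fun hRic (ytil s)
      simp only [add_apply, sub_apply, comp_apply, smul_apply, zero_apply] at hR
      rw [map_add, map_sub, map_neg, map_smul, hQ1, ← sub_eq_zero, ← neg_eq_zero, ← hR]
      abel
  intro t ht
  refine ⟨by rw [hyQ t ht, hQ2], ?_⟩
  calc ‖y t‖ ≤ Mq * ‖ytil t‖ := hyQ t ht ▸ hQn _
    _ ≤ Mq * (Real.exp (-(2 * γ) * t) * (Mi * ‖y 0‖)) := by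
      gcongr
      exact (hdecay t ht).trans (by gcongr)
    _ = Mq * Mi * Real.exp (-(2 * γ) * t) * ‖y 0‖ := by ring
end

section
/- Assume the Riccati identity A∘Q + Q∘A* − B∘W∘B* + Q∘R∘Q + 2λ·Q = 0, and write A_λ = A + λ·id. Let T > 0, let f, g : [0,T] → H be continuous, and let x, y : [0,T] → H be differentiable functions satisfying x′(s) = A_λ* x(s) + f(s) and y′(s) = A_λ* y(s) + g(s) for all s ∈ [0,T]. Then for every t ∈ [0,T]: ⟨Q x(t), y(t)⟩ − ⟨Q x(0), y(0)⟩ = ∫₀^t ( ⟨W B* x(s), B* y(s)⟩ − ⟨R Q x(s), Q y(s)⟩ ) ds + ∫₀^t ( ⟨Q f(s), y(s)⟩ + ⟨Q g(s), x(s)⟩ ) ds. -/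
open ContinuousLinearMap
open scoped RealInnerProductSpace

/-- The quadratic-form version of the Riccati equation: along the shifted adjoint dynamics the
quadratic form of `Q` has derivative given by the `W` and `R` terms. -/
theorem inner_riccati {H U : Type*} [NormedAddCommGroup H] [InnerProductSpace ℝ H]
    [CompleteSpace H] [NormedAddCommGroup U] [InnerProductSpace ℝ U] [CompleteSpace U]
    {A : H →L[ℝ] H} {B : U →L[ℝ] H} {W : U →L[ℝ] U} {Q R : H →L[ℝ] H} {lam : ℝ}
    (hQ : IsSelfAdjoint Q)
    (hRic : A ∘L Q + Q ∘L (adjoint A) - B ∘L W ∘L (adjoint B) + Q ∘L R ∘L Q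
      + (2 * lam) • Q = 0) (u v : H) :
    ⟪Q u, adjoint (A + lam • (1 : H →L[ℝ] H)) v⟫
        + ⟪Q (adjoint (A + lam • (1 : H →L[ℝ] H)) u), v⟫
      = ⟪W (adjoint B u), adjoint B v⟫ - ⟪R (Q u), Q v⟫ := by
  have hadj : adjoint (A + lam • (1 : H →L[ℝ] H)) u = adjoint A u + lam • u := by
    refine ext_inner_right ℝ fun w => ?_
    simp [adjoint_inner_left, inner_add_left, inner_smul_left]
  have h := congrArg (fun L : H →L[ℝ] H => ⟪L u, v⟫) hRic
  simp only [add_apply, sub_apply, comp_apply, smul_apply, zero_apply, inner_add_left,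
    inner_sub_left, real_inner_smul_left, inner_zero_left] at h
  have hR : ⟪Q (R (Q u)), v⟫ = ⟪R (Q u), Q v⟫ := hQ.isSymmetric _ _
  rw [hadj, adjoint_inner_right, adjoint_inner_right]
  simp only [add_apply, smul_apply, one_apply_eq_self, map_add, map_smul, inner_add_left,
    real_inner_smul_left]
  linarith

/-- Lemma 4.1 of the paper, bounded-operator form: the key identity derived from the
Riccati equation, for two solutions of the inhomogeneous adjoint system
`x' = A_λ* x + f`, `y' = A_λ* y + g` with `A_λ = A + λ·id`. -/
theorem riccati_key_identity
    {H U : Type*} [NormedAddCommGroup H] [InnerProductSpace ℝ H] [CompleteSpace H]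
    [NormedAddCommGroup U] [InnerProductSpace ℝ U] [CompleteSpace U]
    (A : H →L[ℝ] H) (B : U →L[ℝ] H) (W : U →L[ℝ] U) (Q Qinv R : H →L[ℝ] H)
    (lam : ℝ)
    (hW : IsSelfAdjoint W) (hWnonneg : ∀ u : U, 0 ≤ ⟪W u, u⟫)
    (hQ : IsSelfAdjoint Q) (hQpos : ∃ c₀ > 0, ∀ x : H, c₀ * ‖x‖ ^ 2 ≤ ⟪Q x, x⟫)
    (hQinv1 : Q ∘L Qinv = 1) (hQinv2 : Qinv ∘L Q = 1)
    (hR : IsSelfAdjoint R) (hRnonneg : ∀ x : H, 0 ≤ ⟪R x, x⟫)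
    (hRic : A ∘L Q + Q ∘L (adjoint A) - B ∘L W ∘L (adjoint B) + Q ∘L R ∘L Q
      + (2 * lam) • Q = 0)
    (T : ℝ) (hT : 0 < T)
    (f g : ℝ → H) (hf : ContinuousOn f (Set.Icc 0 T)) (hg : ContinuousOn g (Set.Icc 0 T))
    (x y : ℝ → H)
    (hx : ∀ s ∈ Set.Icc (0:ℝ) T,
      HasDerivAt x ((adjoint (A + lam • (1 : H →L[ℝ] H))) (x s) + f s) s)
    (hy : ∀ s ∈ Set.Icc (0:ℝ) T,
      HasDerivAt y ((adjoint (A + lam • (1 : H →L[ℝ] H))) (y s) + g s) s) :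
    ∀ t ∈ Set.Icc (0:ℝ) T,
      ⟪Q (x t), y t⟫ - ⟪Q (x 0), y 0⟫
        = (∫ s in (0:ℝ)..t,
            (⟪W (adjoint B (x s)), adjoint B (y s)⟫ - ⟪R (Q (x s)), Q (y s)⟫))
          + ∫ s in (0:ℝ)..t, (⟪Q (f s), y s⟫ + ⟪Q (g s), x s⟫) := by
  intro t ht
  have hsub : Set.uIcc 0 t ⊆ Set.Icc 0 T := by
    rw [Set.uIcc_of_le ht.1]
    exact Set.Icc_subset_Icc_right ht.2
  have hxc : ContinuousOn x (Set.uIcc 0 t) := fun s hs =>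
    (hx s (hsub hs)).continuousAt.continuousWithinAt
  have hyc : ContinuousOn y (Set.uIcc 0 t) := fun s hs =>
    (hy s (hsub hs)).continuousAt.continuousWithinAt
  have hfc := hf.mono hsub
  have hgc := hg.mono hsub
  have hint₁ : IntervalIntegrable
      (fun s => ⟪W (adjoint B (x s)), adjoint B (y s)⟫ - ⟪R (Q (x s)), Q (y s)⟫)
      MeasureTheory.volume 0 t :=
    ContinuousOn.intervalIntegrable (by fun_prop)
  have hint₂ : IntervalIntegrable (fun s => ⟪Q (f s), y s⟫ + ⟪Q (g s), x s⟫)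
      MeasureTheory.volume 0 t :=
    ContinuousOn.intervalIntegrable (by fun_prop)
  rw [← intervalIntegral.integral_add hint₁ hint₂]
  refine (intervalIntegral.integral_eq_sub_of_hasDerivAt (f := fun s => ⟪Q (x s), y s⟫)
    (fun s hs => ?_) (hint₁.add hint₂)).symm
  have hderiv := (Q.hasFDerivAt.comp_hasDerivAt s (hx s (hsub hs))).inner ℝ (hy s (hsub hs))
  refine hderiv.congr_deriv ?_
  have hg_symm : ⟪Q (g s), x s⟫ = ⟪Q (x s), g s⟫ := by
    rw [real_inner_comm]
    exact (hQ.isSymmetric _ _).symm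
  rw [← inner_riccati hQ hRic, hg_symm, map_add Q, inner_add_left, inner_add_right]
  simp only [Function.comp_apply]
  ring
end

section
/- Let T > 0, let M : H →L[ℝ] H, let f : [0,T] → H, g : [0,T] → H and u : [0,T] → U be continuous, and let y, z : [0,T] → H be differentiable functions satisfying, for all s ∈ [0,T], y′(s) = A y(s) + f(s) + B u(s) + M y(s) and z′(s) = −A* z(s) − g(s). Then for every t ∈ [0,T]: ⟨y(t), z(t)⟩ − ⟨y(0), z(0)⟩ = ∫₀^t ⟨u(s), B* z(s)⟩ ds − ∫₀^t ⟨g(s), y(s)⟩ ds + ∫₀^t ⟨f(s), z(s)⟩ ds + ∫₀^t ⟨M y(s), z(s)⟩ ds. -/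
open ContinuousLinearMap
open scoped RealInnerProductSpace

/-- Lemma 3.2 of the paper, bounded-operator form: the duality (integration by parts)
identity pairing a solution of the forward controlled system
`y' = A y + f + B u + M y` with a solution of the backward adjoint system
`z' = -A* z - g`. -/
theorem duality_integration_by_parts
    {H U : Type*} [NormedAddCommGroup H] [InnerProductSpace ℝ H] [CompleteSpace H]
    [NormedAddCommGroup U] [InnerProductSpace ℝ U] [CompleteSpace U]
    (A : H →L[ℝ] H) (B : U →L[ℝ] H) (M : H →L[ℝ] H)
    (T : ℝ) (hT : 0 < T)
    (f g : ℝ → H) (u : ℝ → U)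
    (hf : ContinuousOn f (Set.Icc 0 T)) (hg : ContinuousOn g (Set.Icc 0 T))
    (hu : ContinuousOn u (Set.Icc 0 T))
    (y z : ℝ → H)
    (hy : ∀ s ∈ Set.Icc (0:ℝ) T,
      HasDerivAt y (A (y s) + f s + B (u s) + M (y s)) s)
    (hz : ∀ s ∈ Set.Icc (0:ℝ) T,
      HasDerivAt z (-(adjoint A (z s)) - g s) s) :
    ∀ t ∈ Set.Icc (0:ℝ) T,
      ⟪y t, z t⟫ - ⟪y 0, z 0⟫
        = (∫ s in (0:ℝ)..t, ⟪u s, adjoint B (z s)⟫)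
          - (∫ s in (0:ℝ)..t, ⟪g s, y s⟫)
          + (∫ s in (0:ℝ)..t, ⟪f s, z s⟫)
          + ∫ s in (0:ℝ)..t, ⟪M (y s), z s⟫ := by
  intro t ht
  have hsub : Set.uIcc 0 t ⊆ Set.Icc 0 T := by
    rw [Set.uIcc_of_le ht.1]
    exact Set.Icc_subset_Icc_right ht.2
  have hyc : ContinuousOn y (Set.Icc 0 T) := HasDerivAt.continuousOn hy
  have hzc : ContinuousOn z (Set.Icc 0 T) := HasDerivAt.continuousOn hz
  have hiu : IntervalIntegrable (fun s => ⟪u s, adjoint B (z s)⟫) MeasureTheory.volume 0 t :=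
    ((hu.inner ((adjoint B).continuous.comp_continuousOn hzc)).mono hsub).intervalIntegrable
  have hig : IntervalIntegrable (fun s => ⟪g s, y s⟫) MeasureTheory.volume 0 t :=
    ((hg.inner hyc).mono hsub).intervalIntegrable
  have hif : IntervalIntegrable (fun s => ⟪f s, z s⟫) MeasureTheory.volume 0 t :=
    ((hf.inner hzc).mono hsub).intervalIntegrable
  have hiM : IntervalIntegrable (fun s => ⟪M (y s), z s⟫) MeasureTheory.volume 0 t :=
    (((M.continuous.comp_continuousOn hyc).inner hzc).mono hsub).intervalIntegrable
  have hderiv : ∀ s ∈ Set.uIcc 0 t, HasDerivAt (fun s => ⟪y s, z s⟫)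
      (⟪u s, adjoint B (z s)⟫ - ⟪g s, y s⟫ + ⟪f s, z s⟫ + ⟪M (y s), z s⟫) s := by
    intro s hs
    refine ((hy s (hsub hs)).inner ℝ (hz s (hsub hs))).congr_deriv ?_
    simp only [inner_add_left, inner_sub_right, inner_neg_right, adjoint_inner_right,
      real_inner_comm (g s)]
    ring
  rw [← intervalIntegral.integral_sub hiu hig,
    ← intervalIntegral.integral_add (hiu.sub hig) hif,
    ← intervalIntegral.integral_add ((hiu.sub hig).add hif) hiM]
  exact (intervalIntegral.integral_eq_sub_of_hasDerivAt hderiv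
    (((hiu.sub hig).add hif).add hiM)).symm
end
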